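/- arXiv:1010.1394 — 3 statements merged into one kernel-verified Lean document; each statement's English description precedes it below -/
import Mathlib

section
/- Let μ be a mean (α,η)-porous Borel probability measure on ℝ^d with bounded support. Then there exist r > 0 and t ∈ ℝ^d such that the pushforward of μ under x ↦ r·x + t is a measure on [0,1)^d which is dyadic mean (k, 2^{-d}·η)-porous, where k = ⌈log₂(4√d/α)⌉. -/
open MeasureTheory Filter Metric Set
open scoped ENNReal NNReal

/-- The porosity `por(μ,x,r,ε)`: the supremum of all `α ≥ 0` such that there is `y` with
`B(y,αr) ⊆ B(x,r)` and `μ(B(y,αr)) ≤ ε·μ(B(x,r))` (closed balls). -/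
noncomputable def por {d : ℕ} (μ : Measure (EuclideanSpace ℝ (Fin d)))
    (x : EuclideanSpace ℝ (Fin d)) (r ε : ℝ) : ℝ :=
  sSup {α : ℝ | 0 ≤ α ∧ ∃ y, Metric.closedBall y (α * r) ⊆ Metric.closedBall x r ∧
    μ (Metric.closedBall y (α * r)) ≤ ENNReal.ofReal ε * μ (Metric.closedBall x r)}

/-- `μ` is mean `(α,η,ε)`-porous: for `μ`-a.e. `x`,
`liminf_n (1/n)·#{i < n : por(μ,x,2^{-i},ε) ≥ α} ≥ η`. -/
def MeanPorousWith {d : ℕ} (μ : Measure (EuclideanSpace ℝ (Fin d))) (α η ε : ℝ) : Prop :=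
  ∀ᵐ x ∂μ, η ≤ Filter.liminf
    (fun n : ℕ =>
      (Set.ncard {i : ℕ | i < n ∧ α ≤ por μ x ((2 : ℝ) ^ (-(i : ℝ))) ε} : ℝ) / n)
    Filter.atTop

/-- `μ` is mean `(α,η)`-porous: it is mean `(α,η,ε)`-porous for all `ε > 0`. -/
def MeanPorous {d : ℕ} (μ : Measure (EuclideanSpace ℝ (Fin d))) (α η : ℝ) : Prop :=
  ∀ ε > 0, MeanPorousWith μ α η ε

/-- The half-open dyadic cube of side `2^{-n}` containing `x`. -/
def dyadicCube (d n : ℕ) (x : EuclideanSpace ℝ (Fin d)) : Set (EuclideanSpace ℝ (Fin d)) :=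
  {y | ∀ j : Fin d, ⌊(2 : ℝ) ^ n * y j⌋ = ⌊(2 : ℝ) ^ n * x j⌋}

/-- `por₂(μ,x,n,ε) ≤ k`: there is `1 ≤ j ≤ k` and a dyadic subcube `R` of `D_n(x)`,
`j` levels below, with `μ(R) ≤ ε·μ(D_n(x))`. -/
def por2Le {d : ℕ} (μ : Measure (EuclideanSpace ℝ (Fin d)))
    (x : EuclideanSpace ℝ (Fin d)) (n k : ℕ) (ε : ℝ) : Prop :=
  ∃ j : ℕ, 1 ≤ j ∧ j ≤ k ∧ ∃ y ∈ dyadicCube d n x,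
    μ (dyadicCube d (n + j) y) ≤ ENNReal.ofReal ε * μ (dyadicCube d n x)

/-- `μ` is dyadic mean `(k,η,ε)`-porous: for `μ`-a.e. `x`,
`liminf_n (1/n)·#{i < n : por₂(μ,x,i,ε) ≤ k} ≥ η`. -/
def DyadicMeanPorousWith {d : ℕ} (μ : Measure (EuclideanSpace ℝ (Fin d)))
    (k : ℕ) (η ε : ℝ) : Prop :=
  ∀ᵐ x ∂μ, η ≤ Filter.liminf
    (fun n : ℕ => (Set.ncard {i : ℕ | i < n ∧ por2Le μ x i k ε} : ℝ) / n) Filter.atTop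

/-- `μ` is dyadic mean `(k,η)`-porous: dyadic mean `(k,η,ε)`-porous for all `ε > 0`. -/
def DyadicMeanPorous {d : ℕ} (μ : Measure (EuclideanSpace ℝ (Fin d))) (k : ℕ) (η : ℝ) : Prop :=
  ∀ ε > 0, DyadicMeanPorousWith μ k η ε

/-- The unit cube `[0,1)^d`. -/
def unitCube (d : ℕ) : Set (EuclideanSpace ℝ (Fin d)) :=
  {x | ∀ j : Fin d, 0 ≤ x j ∧ x j < 1}

theorem le_liminf_iff_of_mem_Icc {u : ℕ → ℝ} (h0 : ∀ n, 0 ≤ u n) (h1 : ∀ n, u n ≤ 1) (c : ℝ) :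
    c ≤ liminf u atTop ↔ ∀ δ > 0, ∀ᶠ n in atTop, c - δ ≤ u n := by
  have hb : IsBoundedUnder (· ≥ ·) atTop u := ⟨0, by simp [h0]⟩
  have hc : IsCoboundedUnder (· ≥ ·) atTop u :=
    IsBoundedUnder.isCoboundedUnder_ge ⟨1, by simp [h1]⟩
  constructor
  · intro h δ hδ
    filter_upwards [eventually_lt_of_lt_liminf (show c - δ < liminf u atTop by linarith) hb]
      with n hn using hn.le
  · intro h
    refine le_of_forall_pos_sub_le fun δ hδ => ?_
    exact le_liminf_of_le hc (h δ hδ)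

open Classical in
theorem ncard_setOf_lt_and (p : ℕ → Prop) (n : ℕ) :
    {i : ℕ | i < n ∧ p i}.ncard = Nat.count p n := by
  rw [Nat.count_eq_card_filter_range, ← Set.ncard_coe_finset]
  congr 1
  ext i
  simp

theorem ncard_setOf_lt_and_div_nonneg (p : ℕ → Prop) (n : ℕ) :
    (0 : ℝ) ≤ ({i : ℕ | i < n ∧ p i}.ncard : ℝ) / n := by positivity

theorem ncard_setOf_lt_and_div_le_one (p : ℕ → Prop) (n : ℕ) :
    ({i : ℕ | i < n ∧ p i}.ncard : ℝ) / n ≤ 1 := by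
  classical
  rw [ncard_setOf_lt_and]
  refine div_le_one_of_le₀ ?_ (Nat.cast_nonneg n)
  exact_mod_cast Nat.count_le p

theorem le_liminf_ncard_iff (p : ℕ → Prop) (c : ℝ) :
    c ≤ liminf (fun n : ℕ => ({i : ℕ | i < n ∧ p i}.ncard : ℝ) / n) atTop ↔
      ∀ δ > 0, ∀ᶠ n : ℕ in atTop, c - δ ≤ ({i : ℕ | i < n ∧ p i}.ncard : ℝ) / n :=
  le_liminf_iff_of_mem_Icc (ncard_setOf_lt_and_div_nonneg p) (ncard_setOf_lt_and_div_le_one p) c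

/-- Lower densities are unaffected by shifting indices and grow with the set. -/
theorem le_liminf_ncard_of_shift {p q : ℕ → Prop} (M : ℕ) (hpq : ∀ i, p i → q (i + M)) {c : ℝ}
    (h : c ≤ liminf (fun n : ℕ => ({i : ℕ | i < n ∧ p i}.ncard : ℝ) / n) atTop) :
    c ≤ liminf (fun n : ℕ => ({i : ℕ | i < n ∧ q i}.ncard : ℝ) / n) atTop := by
  classical
  rw [le_liminf_ncard_iff] at h ⊢
  intro δ hδ
  have hM : Tendsto (fun n : ℕ => (M : ℝ) / n) atTop (nhds 0) :=
    tendsto_const_div_atTop_nhds_zero_nat _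
  filter_upwards [h (δ / 2) (by linarith), hM.eventually (gt_mem_nhds (half_pos hδ))]
    with n h1 h2
  have key : ({i : ℕ | i < n ∧ p i}.ncard : ℝ) ≤ {i : ℕ | i < n ∧ q i}.ncard + M := by
    have h3 : Nat.count p n ≤ Nat.count q (M + n) := by
      rw [Nat.count_add]
      refine (Nat.count_mono_left fun i _ hi => ?_).trans (Nat.le_add_left _ _)
      simpa [add_comm] using hpq i hi
    rw [add_comm M n, Nat.count_add] at h3
    have h4 : Nat.count (fun k => q (n + k)) M ≤ M := Nat.count_le _
    rw [ncard_setOf_lt_and, ncard_setOf_lt_and]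
    exact_mod_cast h3.trans (by omega)
  have := div_le_div_of_nonneg_right key (Nat.cast_nonneg (α := ℝ) n)
  rw [add_div] at this
  linarith

open Classical in
theorem sum_range_count_nth (p : ℕ → Prop) (f : ℕ → ℝ) (n : ℕ) :
    ∑ k ∈ Finset.range (Nat.count p n), f (Nat.nth p k) =
      ∑ i ∈ Finset.range n, if p i then f i else 0 := by
  induction n with
  | zero => simp
  | succ n ih =>
    rw [Finset.sum_range_succ, ← ih, Nat.count_succ]
    by_cases h : p n
    · simp [h, Finset.sum_range_succ, Nat.nth_count]
    · simp [h]

open Classical in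
theorem ncard_setOf_lt_and_eq_sum (p : ℕ → Prop) (n : ℕ) :
    ({i : ℕ | i < n ∧ p i}.ncard : ℝ) = ∑ i ∈ Finset.range n, if p i then 1 else 0 := by
  rw [ncard_setOf_lt_and, Nat.count_eq_card_filter_range]
  simp

open Classical in
theorem tendsto_count_of_pos_le_liminf {p : ℕ → Prop} {c : ℝ} (hc : 0 < c)
    (h : c ≤ liminf (fun n : ℕ => ({i : ℕ | i < n ∧ p i}.ncard : ℝ) / n) atTop) :
    Tendsto (Nat.count p) atTop atTop := by
  rw [le_liminf_ncard_iff] at h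
  rw [← tendsto_natCast_atTop_iff (R := ℝ)]
  refine tendsto_atTop_mono' _ (f₁ := fun n : ℕ => c / 2 * n) ?_
    (tendsto_natCast_atTop_atTop.const_mul_atTop (half_pos hc))
  filter_upwards [h (c / 2) (half_pos hc), eventually_gt_atTop 0] with n hn h0
  rw [ncard_setOf_lt_and, le_div_iff₀ (by exact_mod_cast h0)] at hn
  linarith

open ProbabilityTheory in
theorem indepFun_indicator_one {Ω : Type*} [MeasurableSpace Ω] {P : Measure Ω}
    {A B : Set Ω} (h : IndepSet A B P) :
    IndepFun (A.indicator (1 : Ω → ℝ)) (B.indicator (1 : Ω → ℝ)) P := by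
  rw [IndepFun_iff_Indep]
  refine indep_of_indep_of_le_left (indep_of_indep_of_le_right h ?_) ?_
  all_goals
    refine Measurable.comap_le ?_
    refine Measurable.indicator ?_ (MeasurableSpace.measurableSet_generateFrom rfl)
    exact @measurable_const _ _ _ (_) _

open ProbabilityTheory in
theorem identDistrib_indicator_one {Ω : Type*} [MeasurableSpace Ω] {P : Measure Ω}
    [IsProbabilityMeasure P] {A B : Set Ω} (hA : MeasurableSet A) (hB : MeasurableSet B)
    (h : P A = P B) :
    IdentDistrib (A.indicator (1 : Ω → ℝ)) (B.indicator (1 : Ω → ℝ)) P P := by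
  classical
  have mA : Measurable (A.indicator (1 : Ω → ℝ)) := measurable_one.indicator hA
  have mB : Measurable (B.indicator (1 : Ω → ℝ)) := measurable_one.indicator hB
  have h' : P Aᶜ = P Bᶜ := by
    rw [prob_compl_eq_one_sub hA, prob_compl_eq_one_sub hB, h]
  refine ⟨mA.aemeasurable, mB.aemeasurable, ?_⟩
  ext s hs
  rw [Measure.map_apply mA hs, Measure.map_apply mB hs]
  have key (C : Set Ω) : C.indicator (1 : Ω → ℝ) ⁻¹' s =
      if (1 : ℝ) ∈ s then (if (0 : ℝ) ∈ s then univ else C)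
        else (if (0 : ℝ) ∈ s then Cᶜ else ∅) := by
    ext x
    by_cases hx : x ∈ C <;> by_cases h1 : (1 : ℝ) ∈ s <;> by_cases h0 : (0 : ℝ) ∈ s <;>
      simp [hx, h1, h0]
  rw [key, key]
  split_ifs <;> simp [h, h']

/-- Sampling a set of positive lower density by pairwise independent events of equal probability
`q` almost surely keeps at least the proportion `q` of the lower density. -/
theorem ae_le_liminf_ncard_of_pairwise_indepSet {Ω : Type*} [MeasurableSpace Ω] {P : Measure Ω}
    [IsProbabilityMeasure P] {E : ℕ → Set Ω} (hE : ∀ i, MeasurableSet (E i))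
    (hind : Pairwise fun i j => ProbabilityTheory.IndepSet (E i) (E j) P) {q : ℝ}
    (hq : ∀ i, P.real (E i) = q) {p : ℕ → Prop} {c : ℝ} (hc : 0 < c)
    (h : c ≤ liminf (fun n : ℕ => ({i : ℕ | i < n ∧ p i}.ncard : ℝ) / n) atTop) :
    ∀ᵐ ω ∂P, q * c ≤
      liminf (fun n : ℕ => ({i : ℕ | i < n ∧ (p i ∧ ω ∈ E i)}.ncard : ℝ) / n) atTop := by
  classical
  have hcount := tendsto_count_of_pos_le_liminf hc h
  have hq0 : 0 ≤ q := hq 0 ▸ measureReal_nonneg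
  have hinf : {i | p i}.Infinite := by
    intro hfin
    obtain ⟨n, hn⟩ := (hcount.eventually (eventually_gt_atTop hfin.toFinset.card)).exists
    rw [Nat.count_eq_card_filter_range] at hn
    refine absurd (Finset.card_le_card (fun i hi => ?_)) (not_le.mpr hn)
    simpa using (Finset.mem_filter.mp hi).2
  have hPE (i j : ℕ) : P (E i) = P (E j) := by
    have := (hq i).trans (hq j).symm
    rwa [measureReal_def, measureReal_def,
      ENNReal.toReal_eq_toReal_iff' (measure_ne_top _ _) (measure_ne_top _ _)] at this
  have slln := ProbabilityTheory.strong_law_ae_real (μ := P)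
    (fun k => (E (Nat.nth p k)).indicator (1 : Ω → ℝ))
    ((integrable_const (1 : ℝ)).indicator (hE _))
    (fun i j hij => indepFun_indicator_one
      (hind fun h => hij (Nat.nth_injective hinf h)))
    (fun i => identDistrib_indicator_one (hE _) (hE _) (hPE _ _))
  filter_upwards [slln] with ω hω
  rw [integral_indicator_one (hE _), hq] at hω
  rw [le_liminf_ncard_iff] at h ⊢
  have hω' := hω.comp hcount
  intro δ hδ
  obtain ⟨δ', hδ', hδ1⟩ : ∃ δ' > 0, q * c - δ ≤ (q - δ') * (c - δ') ∧ δ' ≤ c ∧ δ' * (q + c) ≤ δ := by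
    refine ⟨min c (δ / (q + c)), by positivity, ?_⟩
    have h1 : min c (δ / (q + c)) * (q + c) ≤ δ := by
      rw [← le_div_iff₀ (by positivity)]
      exact min_le_right _ _
    exact ⟨by nlinarith [sq_nonneg (min c (δ / (q + c)))], min_le_left _ _, h1⟩
  filter_upwards [h δ' hδ', hω'.eventually (lt_mem_nhds (show q - δ' < q by linarith)),
    hcount.eventually (eventually_gt_atTop 0), eventually_gt_atTop 0] with n h1 h2 h3 h4
  have h4' : (0 : ℝ) < n := by exact_mod_cast h4
  have h3' : (0 : ℝ) < Nat.count p n := by exact_mod_cast h3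
  have hsum : ({i : ℕ | i < n ∧ (p i ∧ ω ∈ E i)}.ncard : ℝ) =
      ∑ k ∈ Finset.range (Nat.count p n), (E (Nat.nth p k)).indicator (1 : Ω → ℝ) ω := by
    rw [sum_range_count_nth p (fun i => (E i).indicator (1 : Ω → ℝ) ω),
      ncard_setOf_lt_and_eq_sum]
    refine Finset.sum_congr rfl fun i _ => ?_
    by_cases hp : p i <;> by_cases hi : ω ∈ E i <;> simp [hp, hi]
  rw [ncard_setOf_lt_and] at h1
  simp only [Function.comp] at h2
  rw [← hsum] at h2
  set S : ℝ := ({i : ℕ | i < n ∧ (p i ∧ ω ∈ E i)}.ncard : ℝ)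
  have hS : S / n = S / Nat.count p n * (Nat.count p n / n) := by field_simp
  have hS0 : 0 ≤ S / Nat.count p n := by positivity
  rw [hS]
  calc q * c - δ ≤ (q - δ') * (c - δ') := hδ1.1
    _ ≤ S / Nat.count p n * (c - δ') :=
      mul_le_mul_of_nonneg_right h2.le (by linarith [hδ1.2.1])
    _ ≤ _ := mul_le_mul_of_nonneg_left h1 hS0

section dyadicMiddle

/-- The points `s` for which `c + s` lies in the middle half of its dyadic interval of
length `2^{-a}`. -/
def dyadicMiddle (c : ℝ) (a : ℕ) : Set ℝ :=
  {s | Int.fract ((2 : ℝ) ^ a * (c + s)) ∈ Ico (1 / 4 : ℝ) (3 / 4)}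

theorem measurableSet_dyadicMiddle (c : ℝ) (a : ℕ) : MeasurableSet (dyadicMiddle c a) := by
  have : Measurable fun s : ℝ => Int.fract ((2 : ℝ) ^ a * (c + s)) := by fun_prop
  exact this measurableSet_Ico

theorem fract_add_half_mem_Ico_iff (x : ℝ) :
    Int.fract (x + 1 / 2) ∈ Ico (1 / 4 : ℝ) (3 / 4) ↔
      Int.fract x ∉ Ico (1 / 4 : ℝ) (3 / 4) := by
  have h0 := Int.fract_nonneg x
  have h1 := Int.fract_lt_one x
  simp only [mem_Ico]
  rcases lt_or_ge (Int.fract x) (1 / 2) with h | h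
  · have : Int.fract (x + 1 / 2) = Int.fract x + 1 / 2 := by
      rw [Int.fract_eq_iff]
      refine ⟨by linarith, by linarith, ⌊x⌋, ?_⟩
      rw [Int.fract]; ring
    rw [this]
    constructor
    · rintro ⟨h2, h3⟩ ⟨h4, h5⟩
      linarith
    · intro h2
      refine ⟨by linarith, ?_⟩
      by_contra h3
      exact h2 ⟨by linarith, by linarith⟩
  · have : Int.fract (x + 1 / 2) = Int.fract x - 1 / 2 := by
      rw [Int.fract_eq_iff]
      refine ⟨by linarith, by linarith, ⌊x⌋ + 1, ?_⟩
      rw [Int.fract]; push_cast; ring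
    rw [this]
    constructor
    · rintro ⟨h2, h3⟩ ⟨h4, h5⟩
      linarith
    · intro h2
      refine ⟨?_, by linarith⟩
      by_contra h3
      exact h2 ⟨by linarith, by linarith⟩

theorem add_half_pow_mem_dyadicMiddle_iff (c : ℝ) (a : ℕ) (s : ℝ) :
    s + (2 : ℝ)⁻¹ ^ (a + 1) ∈ dyadicMiddle c a ↔ s ∉ dyadicMiddle c a := by
  have : (2 : ℝ) ^ a * (c + (s + (2 : ℝ)⁻¹ ^ (a + 1))) = (2 : ℝ) ^ a * (c + s) + 1 / 2 := by
    rw [inv_pow, pow_succ]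
    field_simp
    ring
  simp only [dyadicMiddle, mem_ofPred_eq, this, fract_add_half_mem_Ico_iff]

theorem add_half_pow_mem_dyadicMiddle_iff_of_le (c : ℝ) {a b : ℕ} (h : b ≤ a) (s : ℝ) :
    s + (2 : ℝ)⁻¹ ^ b ∈ dyadicMiddle c a ↔ s ∈ dyadicMiddle c a := by
  obtain ⟨m, rfl⟩ := Nat.exists_eq_add_of_le h
  have : (2 : ℝ) ^ (b + m) * (c + (s + (2 : ℝ)⁻¹ ^ b)) =
      (2 : ℝ) ^ (b + m) * (c + s) + ((2 ^ m : ℕ) : ℝ) := by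
    rw [inv_pow, pow_add]
    push_cast
    field_simp
    ring
  simp only [dyadicMiddle, mem_ofPred_eq, this, Int.fract_add_natCast]

theorem measureReal_preimage_add_of_periodic {K : Set ℝ} (hK : MeasurableSet K)
    (hper : ∀ s, s + 1 ∈ K ↔ s ∈ K) (h : ℝ) :
    (volume.restrict (Ioc (0 : ℝ) 1)).real ((· + h) ⁻¹' K) =
      (volume.restrict (Ioc (0 : ℝ) 1)).real K := by
  have hreal (L : Set ℝ) (hL : MeasurableSet L) :
      (volume.restrict (Ioc (0 : ℝ) 1)).real L = ∫ s in (0 : ℝ)..1, L.indicator 1 s := by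
    rw [intervalIntegral.integral_of_le zero_le_one, integral_indicator_one hL]
  have hP : Function.Periodic (K.indicator (1 : ℝ → ℝ)) 1 := by
    intro s
    by_cases hs : s ∈ K <;> simp [hs, hper]
  rw [hreal _ hK, hreal _ (measurable_add_const h hK)]
  have h1 := intervalIntegral.integral_comp_add_right (a := 0) (b := 1)
    (K.indicator (1 : ℝ → ℝ)) h
  have h2 := hP.intervalIntegral_add_eq h 0
  rw [zero_add] at h2
  rw [← h2, add_comm h 1, ← zero_add h, ← add_assoc, add_zero, ← h1]
  simp only [zero_add]
  rfl

/-- A periodic set invariant under translation by half a dyadic step is split evenly by the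
middle set of that step. -/
theorem measureReal_inter_dyadicMiddle {K : Set ℝ} (hK : MeasurableSet K) (c : ℝ) (a : ℕ)
    (hper : ∀ s, s + 1 ∈ K ↔ s ∈ K) (hKa : ∀ s, s + (2 : ℝ)⁻¹ ^ (a + 1) ∈ K ↔ s ∈ K) :
    (volume.restrict (Ioc (0 : ℝ) 1)).real (K ∩ dyadicMiddle c a) =
      (volume.restrict (Ioc (0 : ℝ) 1)).real K / 2 := by
  have hM := measurableSet_dyadicMiddle c a
  have h1 := measureReal_preimage_add_of_periodic (hK.inter hM) (fun s => by
    have := add_half_pow_mem_dyadicMiddle_iff_of_le c (Nat.zero_le a) s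
    rw [pow_zero] at this
    simp only [mem_inter_iff, hper, this]) ((2 : ℝ)⁻¹ ^ (a + 1))
  have h2 : (· + (2 : ℝ)⁻¹ ^ (a + 1)) ⁻¹' (K ∩ dyadicMiddle c a) = K \ dyadicMiddle c a := by
    ext s
    simp only [mem_preimage, mem_inter_iff, hKa, add_half_pow_mem_dyadicMiddle_iff, Set.mem_sdiff]
  rw [h2] at h1
  have h3 := measureReal_inter_add_sdiff (μ := volume.restrict (Ioc (0 : ℝ) 1)) (s := K) hM
  linarith

theorem measureReal_dyadicMiddle (c : ℝ) (a : ℕ) :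
    (volume.restrict (Ioc (0 : ℝ) 1)).real (dyadicMiddle c a) = 1 / 2 := by
  have := measureReal_inter_dyadicMiddle MeasurableSet.univ c a (by simp) (by simp)
  simpa using this

theorem measureReal_dyadicMiddle_inter (c : ℝ) {a b : ℕ} (h : a ≠ b) :
    (volume.restrict (Ioc (0 : ℝ) 1)).real (dyadicMiddle c a ∩ dyadicMiddle c b) =
      1 / 2 * (1 / 2) := by
  wlog hab : a < b generalizing a b
  · rw [inter_comm, this h.symm (by omega)]
  rw [inter_comm, measureReal_inter_dyadicMiddle (measurableSet_dyadicMiddle c b) c a,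
    measureReal_dyadicMiddle]
  · ring
  · simpa using add_half_pow_mem_dyadicMiddle_iff_of_le c (Nat.zero_le b)
  · exact add_half_pow_mem_dyadicMiddle_iff_of_le c hab

end dyadicMiddle

/-- The uniform distribution on the cube `(0,1]^d`. -/
noncomputable def uniformCube (d : ℕ) : Measure (Fin d → ℝ) :=
  Measure.pi fun _ => volume.restrict (Ioc (0 : ℝ) 1)

instance (d : ℕ) : IsProbabilityMeasure (uniformCube d) := by
  have : IsProbabilityMeasure (volume.restrict (Ioc (0 : ℝ) 1)) := ⟨by simp⟩
  unfold uniformCube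
  infer_instance

theorem uniformCube_real_pi {d : ℕ} (s : Fin d → Set ℝ) :
    (uniformCube d).real (univ.pi s) =
      ∏ j, (volume.restrict (Ioc (0 : ℝ) 1)).real (s j) := by
  simp only [measureReal_def, uniformCube, Measure.pi_pi, ENNReal.toReal_prod]

theorem uniformCube_real_pi_dyadicMiddle {d : ℕ} (c : Fin d → ℝ) (a : ℕ) :
    (uniformCube d).real (univ.pi fun j => dyadicMiddle (c j) a) = ((2 : ℝ) ^ d)⁻¹ := by
  simp only [uniformCube_real_pi, measureReal_dyadicMiddle]
  simp

theorem measurableSet_pi_dyadicMiddle {d : ℕ} (c : Fin d → ℝ) (a : ℕ) :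
    MeasurableSet (univ.pi fun j => dyadicMiddle (c j) a) :=
  MeasurableSet.univ_pi fun j => measurableSet_dyadicMiddle (c j) a

theorem indepSet_pi_dyadicMiddle {d : ℕ} (c : Fin d → ℝ) {a b : ℕ} (h : a ≠ b) :
    ProbabilityTheory.IndepSet (univ.pi fun j => dyadicMiddle (c j) a)
      (univ.pi fun j => dyadicMiddle (c j) b) (uniformCube d) := by
  rw [ProbabilityTheory.indepSet_iff_measure_inter_eq_mul (measurableSet_pi_dyadicMiddle c a)
    (measurableSet_pi_dyadicMiddle c b) (uniformCube d)]
  rw [← ENNReal.toReal_eq_toReal_iff' (measure_ne_top _ _)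
    (ENNReal.mul_ne_top (measure_ne_top _ _) (measure_ne_top _ _)), ENNReal.toReal_mul]
  simp only [← measureReal_def, ← pi_inter_distrib]
  simp only [uniformCube_real_pi, measureReal_dyadicMiddle,
    measureReal_dyadicMiddle_inter _ h, Finset.prod_const, mul_pow]

section porousPoints

variable {d : ℕ}

/-- The points `x` such that some open ball of radius `αr` centred in `B(x,r)` carries at most
the proportion `ε` of the measure of `B(x,r)`. -/
def porousPoints (μ : Measure (EuclideanSpace ℝ (Fin d))) (α r ε : ℝ) :
    Set (EuclideanSpace ℝ (Fin d)) :=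
  {x | ∃ y ∈ closedBall x r,
    μ (ball y (α * r)) ≤ ENNReal.ofReal ε * μ (closedBall x r)}

theorem measure_ball_le_of_tendsto {X : Type*} [PseudoMetricSpace X] [MeasurableSpace X]
    [OpensMeasurableSpace X] {μ : Measure X} [IsFiniteMeasure μ] {x y : ℕ → X} {s : ℕ → ℝ}
    {x₀ y₀ : X} {r s₀ ε : ℝ} (hx : Tendsto x atTop (nhds x₀)) (hy : Tendsto y atTop (nhds y₀))
    (hs : Tendsto s atTop (nhds s₀))
    (h : ∀ n, μ (ball (y n) (s n)) ≤ ENNReal.ofReal ε * μ (closedBall (x n) r)) :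
    μ (ball y₀ s₀) ≤ ENNReal.ofReal ε * μ (closedBall x₀ r) := by
  set V : ℕ → Set X := fun N => ⋂ n ≥ N, ball (y n) (s n)
  set W : ℕ → Set X := fun N => ⋃ n ≥ N, closedBall (x n) r
  have hV : Monotone V := fun a b hab => biInter_mono (fun n hn => le_trans hab hn)
    fun _ _ => Subset.rfl
  have hW : Antitone W := fun a b hab => biUnion_mono (fun n hn => le_trans hab hn)
    fun _ _ => Subset.rfl
  have hWm (N : ℕ) : MeasurableSet (W N) :=
    MeasurableSet.biUnion (Set.to_countable _) fun _ _ => isClosed_closedBall.measurableSet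
  have h1 : ball y₀ s₀ ⊆ ⋃ N, V N := by
    intro z hz
    have hz' : ∀ᶠ n in atTop, dist z (y n) < s n :=
      (tendsto_const_nhds.dist hy).eventually_lt hs hz
    obtain ⟨N, hN⟩ := eventually_atTop.mp hz'
    exact mem_iUnion.mpr ⟨N, mem_iInter₂.mpr hN⟩
  have h2 : ⋂ N, W N ⊆ closedBall x₀ r := by
    intro z hz
    refine le_of_tendsto_of_frequently (tendsto_const_nhds.dist hx) ?_
    refine frequently_atTop.mpr fun N => ?_
    obtain ⟨n, hn, hzn⟩ := mem_iUnion₂.mp (mem_iInter.mp hz N)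
    exact ⟨n, hn, hzn⟩
  refine (measure_mono h1).trans (le_trans ?_ (mul_le_mul_right (measure_mono h2) _))
  refine le_of_tendsto_of_tendsto' (tendsto_measure_iUnion_atTop hV)
    (ENNReal.Tendsto.const_mul (tendsto_measure_iInter_atTop
      (fun N => (hWm N).nullMeasurableSet) hW ⟨0, measure_ne_top _ _⟩)
      (Or.inr ENNReal.ofReal_ne_top)) fun N => ?_
  calc μ (V N) ≤ μ (ball (y N) (s N)) :=
        measure_mono (biInter_subset_of_mem (mem_Ici.mpr le_rfl))
    _ ≤ ENNReal.ofReal ε * μ (closedBall (x N) r) := h N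
    _ ≤ ENNReal.ofReal ε * μ (W N) :=
      mul_le_mul_right (measure_mono
        (subset_biUnion_of_mem (u := fun n => closedBall (x n) r) (mem_Ici.mpr le_rfl))) _

theorem mem_porousPoints_of_tendsto {μ : Measure (EuclideanSpace ℝ (Fin d))}
    [IsFiniteMeasure μ] {x y : ℕ → EuclideanSpace ℝ (Fin d)} {s : ℕ → ℝ}
    {x₀ : EuclideanSpace ℝ (Fin d)} {α r ε : ℝ} (hx : Tendsto x atTop (nhds x₀))
    (hs : Tendsto s atTop (nhds α)) (hy : ∀ n, y n ∈ closedBall (x n) r)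
    (h : ∀ n, μ (ball (y n) (s n * r)) ≤ ENNReal.ofReal ε * μ (closedBall (x n) r)) :
    x₀ ∈ porousPoints μ α r ε := by
  have hbdd : Bornology.IsBounded (range y) := by
    obtain ⟨R, hR⟩ := (isBounded_range_of_tendsto x hx).subset_closedBall x₀
    refine isBounded_closedBall.subset (?_ : range y ⊆ closedBall x₀ (r + R))
    rintro _ ⟨n, rfl⟩
    exact (dist_triangle _ (x n) _).trans (add_le_add (hy n) (hR (mem_range_self n)))
  obtain ⟨y₀, -, φ, hφ, hy₀⟩ := tendsto_subseq_of_bounded hbdd fun n => mem_range_self n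
  have hxφ := hx.comp hφ.tendsto_atTop
  refine ⟨y₀, le_of_tendsto' (hy₀.dist hxφ) fun n => hy (φ n), ?_⟩
  exact measure_ball_le_of_tendsto hxφ hy₀ ((hs.comp hφ.tendsto_atTop).mul_const r)
    fun n => h (φ n)

theorem isClosed_porousPoints (μ : Measure (EuclideanSpace ℝ (Fin d))) [IsFiniteMeasure μ]
    (α r ε : ℝ) : IsClosed (porousPoints μ α r ε) := by
  refine IsSeqClosed.isClosed fun x x₀ hx hx₀ => ?_
  choose y hy h using hx
  exact mem_porousPoints_of_tendsto hx₀ tendsto_const_nhds hy h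

theorem mem_porousPoints_of_le_por {μ : Measure (EuclideanSpace ℝ (Fin d))} [IsFiniteMeasure μ]
    {x : EuclideanSpace ℝ (Fin d)} {α r ε : ℝ} (hα : 0 < α) (hr : 0 < r)
    (h : α ≤ por μ x r ε) : x ∈ porousPoints μ α r ε := by
  have key (n : ℕ) : ∃ y ∈ closedBall x r,
      μ (ball y ((α - 1 / ((n : ℝ) + 1)) * r)) ≤ ENNReal.ofReal ε * μ (closedBall x r) := by
    have hn : (0 : ℝ) < 1 / ((n : ℝ) + 1) := Nat.one_div_pos_of_nat
    obtain ⟨β, ⟨hβ0, y, hy, hμ⟩, hβ⟩ := exists_lt_of_lt_csSup (nonempty_iff_ne_empty.mpr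
      fun h0 => by rw [por, h0, Real.sSup_empty] at h; linarith)
      (show α - 1 / ((n : ℝ) + 1) < por μ x r ε by linarith)
    refine ⟨y, hy (mem_closedBall_self (by positivity)), (measure_mono ?_).trans hμ⟩
    exact ball_subset_closedBall.trans (closedBall_subset_closedBall (by gcongr))
  choose y hy h using key
  refine mem_porousPoints_of_tendsto tendsto_const_nhds ?_ hy h
  simpa using tendsto_const_nhds.sub (tendsto_one_div_add_atTop_nhds_zero_nat (𝕜 := ℝ))

end porousPoints

section dyadicCube

variable {d : ℕ}

theorem abs_apply_sub_le_dist (x y : EuclideanSpace ℝ (Fin d)) (j : Fin d) :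
    |x j - y j| ≤ dist x y := by
  rw [dist_eq_norm]
  exact PiLp.norm_apply_le (x - y) j

theorem closedBall_subset_dyadicCube {l : ℕ} {x : EuclideanSpace ℝ (Fin d)} {ρ : ℝ}
    (hρ : (2 : ℝ) ^ l * ρ ≤ 1 / 4)
    (h : ∀ j, Int.fract ((2 : ℝ) ^ l * x j) ∈ Ico (1 / 4 : ℝ) (3 / 4)) :
    closedBall x ρ ⊆ dyadicCube d l x := by
  intro y hy j
  have h1 : |(2 : ℝ) ^ l * (y j - x j)| ≤ 1 / 4 := by
    rw [abs_mul, abs_of_pos (by positivity : (0 : ℝ) < 2 ^ l)]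
    refine le_trans ?_ hρ
    gcongr
    exact (abs_apply_sub_le_dist y x j).trans hy
  obtain ⟨h2, h3⟩ := h j
  obtain ⟨h4, h5⟩ := abs_le.mp h1
  rw [Int.fract] at h2 h3
  rw [Int.floor_eq_iff]
  constructor <;> linarith

theorem dist_lt_of_mem_dyadicCube (hd : 1 ≤ d) {n : ℕ} {x y : EuclideanSpace ℝ (Fin d)}
    (h : y ∈ dyadicCube d n x) : dist y x < √d / 2 ^ n := by
  have : Nonempty (Fin d) := ⟨⟨0, hd⟩⟩
  have h1 (j : Fin d) : dist (y j) (x j) ^ 2 < (1 / (2 : ℝ) ^ n) ^ 2 := by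
    have h2 := Int.abs_sub_lt_one_of_floor_eq_floor (h j)
    rw [← mul_sub, abs_mul, abs_of_pos (by positivity : (0 : ℝ) < 2 ^ n)] at h2
    refine pow_lt_pow_left₀ ?_ dist_nonneg two_ne_zero
    rw [Real.dist_eq, lt_div_iff₀ (by positivity)]
    linarith
  rw [EuclideanSpace.dist_eq, Real.sqrt_lt' (by positivity)]
  refine (Finset.sum_lt_sum_of_nonempty Finset.univ_nonempty fun j _ => h1 j).trans_eq ?_
  rw [Finset.sum_const, Finset.card_univ, Fintype.card_fin, nsmul_eq_mul, div_pow, div_pow,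
    Real.sq_sqrt (Nat.cast_nonneg d)]
  ring

theorem por2Le_mono {μ : Measure (EuclideanSpace ℝ (Fin d))} {x : EuclideanSpace ℝ (Fin d)}
    {n k : ℕ} {ε ε' : ℝ} (h : ε ≤ ε') (hp : por2Le μ x n k ε) : por2Le μ x n k ε' := by
  obtain ⟨j, h1, h2, y, hy, hμ⟩ := hp
  exact ⟨j, h1, h2, y, hy, hμ.trans (by gcongr)⟩

theorem measurableEmbedding_smul_add {ρ : ℝ} (hρ : ρ ≠ 0) (t : EuclideanSpace ℝ (Fin d)) :
    MeasurableEmbedding fun x : EuclideanSpace ℝ (Fin d) => ρ • x + t :=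
  (measurableEmbedding_addRight t).comp (measurableEmbedding_const_smul₀ hρ)

/-- If the image of a porous point lies in the middle part of its dyadic cube, then that cube
has an almost empty dyadic subcube. -/
theorem por2Le_map_of_mem_porousPoints (hd : 1 ≤ d) {μ : Measure (EuclideanSpace ℝ (Fin d))}
    {x t : EuclideanSpace ℝ (Fin d)} {α ρ r ε : ℝ} {l k : ℕ} (hρ : 0 < ρ)
    (hl : (2 : ℝ) ^ l * (ρ * r) = 1 / 4) (hk : 1 ≤ k)
    (hkα : 4 * √d ≤ α * 2 ^ k) (hx : x ∈ porousPoints μ α r ε)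
    (hmid : ∀ j, Int.fract ((2 : ℝ) ^ l * (ρ • x + t) j) ∈ Ico (1 / 4 : ℝ) (3 / 4)) :
    por2Le (μ.map fun x => ρ • x + t) (ρ • x + t) l k ε := by
  obtain ⟨y, hy, hμ⟩ := hx
  have hemb := measurableEmbedding_smul_add hρ.ne' t
  have hdist (a b : EuclideanSpace ℝ (Fin d)) :
      dist (ρ • a + t) (ρ • b + t) = ρ * dist a b := by
    rw [dist_add_right, dist_smul₀, Real.norm_of_nonneg hρ.le]
  have hsub := closedBall_subset_dyadicCube hl.le hmid
  have hball (z) (hz : z ∈ closedBall x r) : ρ • z + t ∈ dyadicCube d l (ρ • x + t) := by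
    refine hsub ?_
    rw [mem_closedBall, hdist]
    exact mul_le_mul_of_nonneg_left hz hρ.le
  refine ⟨k, hk, le_rfl, ρ • y + t, hball y hy, ?_⟩
  rw [hemb.map_apply, hemb.map_apply]
  refine (measure_mono fun z hz => ?_).trans
    (hμ.trans (mul_le_mul_right (measure_mono hball) _))
  have h1 := dist_lt_of_mem_dyadicCube hd (mem_preimage.mp hz)
  rw [hdist, lt_div_iff₀ (by positivity), pow_add] at h1
  rw [mem_ball]
  refine lt_of_mul_lt_mul_left ?_ (show 0 ≤ ρ * (2 ^ l * 2 ^ k) by positivity)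
  calc ρ * (2 ^ l * 2 ^ k) * dist z y = ρ * dist z y * (2 ^ l * 2 ^ k) := by ring
    _ < √d := h1
    _ ≤ 2 ^ l * (ρ * r) * (α * 2 ^ k) := by rw [hl]; linarith
    _ = _ := by ring

end dyadicCube

/-- For almost every translation, the dyadic scales at which a point is porous and is mapped to
the middle part of its dyadic cube have lower density at least `2^{-d}η`. -/
theorem ae_uniformCube_ae_le_liminf {d : ℕ} {μ : Measure (EuclideanSpace ℝ (Fin d))}
    [IsProbabilityMeasure μ] {α η ε : ℝ} (hα : 0 < α) (hη : 0 < η)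
    (h : MeanPorousWith μ α η ε) (ρ : ℝ) (M : ℕ) :
    ∀ᵐ t ∂(uniformCube d), ∀ᵐ x ∂μ, ((2 : ℝ) ^ d)⁻¹ * η ≤
      liminf (fun n : ℕ => ({i : ℕ | i < n ∧ (x ∈ porousPoints μ α ((2 : ℝ) ^ (-(i : ℝ))) ε ∧
        t ∈ univ.pi fun j => dyadicMiddle (ρ * x j) (i + M))}.ncard : ℝ) / n) atTop := by
  classical
  rw [← Measure.ae_ae_comm]
  · filter_upwards [h] with x hx
    refine ae_le_liminf_ncard_of_pairwise_indepSet
      (E := fun i => univ.pi fun j => dyadicMiddle (ρ * x j) (i + M))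
      (p := fun i => x ∈ porousPoints μ α ((2 : ℝ) ^ (-(i : ℝ))) ε)
      (fun i => measurableSet_pi_dyadicMiddle _ _)
      (fun i j hij => indepSet_pi_dyadicMiddle _ (by simpa using hij))
      (fun i => uniformCube_real_pi_dyadicMiddle _ _) hη ?_
    exact le_liminf_ncard_of_shift 0
      (fun i hi => mem_porousPoints_of_le_por hα (by positivity) hi) hx
  · refine measurableSet_le measurable_const (Measurable.liminf fun n => ?_)
    simp only [ncard_setOf_lt_and_eq_sum]
    refine Measurable.div_const (Finset.measurable_sum _ fun i _ => ?_) _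
    refine Measurable.ite (MeasurableSet.inter ?_ ?_) measurable_const measurable_const
    · exact measurable_fst (isClosed_porousPoints μ α _ ε).measurableSet
    · have : {a : EuclideanSpace ℝ (Fin d) × (Fin d → ℝ) |
          a.2 ∈ univ.pi fun j => dyadicMiddle (ρ * a.1 j) (i + M)} =
          ⋂ j, (fun a : EuclideanSpace ℝ (Fin d) × (Fin d → ℝ) =>
            Int.fract ((2 : ℝ) ^ (i + M) * (ρ * a.1 j + a.2 j))) ⁻¹'
              Ico (1 / 4 : ℝ) (3 / 4) := by
        ext a
        simp [dyadicMiddle, Set.mem_pi]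
      change MeasurableSet {a : EuclideanSpace ℝ (Fin d) × (Fin d → ℝ) |
          a.2 ∈ univ.pi fun j => dyadicMiddle (ρ * a.1 j) (i + M)}
      rw [this]
      refine MeasurableSet.iInter fun j => ?_
      refine Measurable.comp (g := Int.fract) (by fun_prop) ?_ measurableSet_Ico
      fun_prop

theorem smul_add_toLp_mem_unitCube {d : ℕ} {ρ R : ℝ} (hρ : 0 < ρ) (hρR : ρ * R ≤ 1 / 4)
    {t : Fin d → ℝ} (ht : t ∈ univ.pi fun _ : Fin d => Ico (1 / 4 : ℝ) (3 / 4))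
    {x : EuclideanSpace ℝ (Fin d)} (hx : x ∈ closedBall 0 R) :
    ρ • x + WithLp.toLp 2 t ∈ unitCube d := by
  intro j
  obtain ⟨h1, h2⟩ := ht j (mem_univ j)
  have h3 : |x j| ≤ R := by
    simpa using (abs_apply_sub_le_dist x 0 j).trans hx
  have h4 : |ρ * x j| ≤ 1 / 4 := by
    rw [abs_mul, abs_of_pos hρ]
    exact (mul_le_mul_of_nonneg_left h3 hρ.le).trans hρR
  obtain ⟨h5, h6⟩ := abs_le.mp h4
  simp only [PiLp.add_apply, PiLp.smul_apply, smul_eq_mul]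
  constructor <;> linarith

theorem uniformCube_middle_ne_zero (d : ℕ) :
    uniformCube d (univ.pi fun _ : Fin d => Ico (1 / 4 : ℝ) (3 / 4)) ≠ 0 := by
  have h : Ico (1 / 4 : ℝ) (3 / 4) ∩ Ioc 0 1 = Ico (1 / 4) (3 / 4) :=
    inter_eq_left.mpr fun s hs => ⟨by linarith [hs.1], by linarith [hs.2]⟩
  rw [uniformCube, Measure.pi_pi, Finset.prod_ne_zero_iff]
  intro j _
  rw [Measure.restrict_apply measurableSet_Ico, h, Real.volume_Ico]
  simp only [ne_eq, ENNReal.ofReal_eq_zero]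
  norm_num

theorem four_mul_sqrt_le_mul_two_pow_ceil {d : ℕ} (hd : 1 ≤ d) {α : ℝ} (hα : 0 < α) :
    4 * √d ≤ α * 2 ^ ⌈Real.logb 2 (4 * √d / α)⌉₊ := by
  have hd' : (0 : ℝ) < √d := Real.sqrt_pos.mpr (by exact_mod_cast hd)
  have h := Nat.le_ceil (Real.logb 2 (4 * √d / α))
  rw [Real.logb_le_iff_le_rpow one_lt_two (by positivity), Real.rpow_natCast,
    div_le_iff₀ hα] at h
  linarith

theorem one_le_ceil_logb {d : ℕ} (hd : 1 ≤ d) {α : ℝ} (hα : 0 < α) (hα' : α ≤ 1 / 2) :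
    1 ≤ ⌈Real.logb 2 (4 * √d / α)⌉₊ := by
  have hd' : (1 : ℝ) ≤ √d := Real.one_le_sqrt.mpr (by exact_mod_cast hd)
  refine Nat.one_le_ceil_iff.mpr (Real.logb_pos one_lt_two ?_)
  rw [lt_div_iff₀ hα]
  linarith

/-- Let `μ` be a mean `(α,η)`-porous Borel probability measure on `ℝ^d`
with bounded support. Then there are `r > 0` and `t ∈ ℝ^d` such that the pushforward of `μ`
under `x ↦ r·x + t` is a measure on `[0,1)^d` which is dyadic mean `(k, 2^{-d}·η)`-porous,
where `k = ⌈log₂(4√d/α)⌉`. -/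
theorem exists_homothety_dyadicMeanPorous (d : ℕ) (hd : 1 ≤ d) (α η : ℝ)
    (hα : 0 < α) (hα' : α ≤ 1 / 2) (hη : 0 < η) (hη' : η ≤ 1)
    (μ : Measure (EuclideanSpace ℝ (Fin d))) [IsProbabilityMeasure μ]
    (hbdd : ∃ R : ℝ, μ (Metric.closedBall 0 R) = 1)
    (hpor : MeanPorous μ α η) :
    ∃ r > (0 : ℝ), ∃ t : EuclideanSpace ℝ (Fin d),
      (Measure.map (fun x => r • x + t) μ) (unitCube d) = 1 ∧
      DyadicMeanPorous (Measure.map (fun x => r • x + t) μ)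
        (⌈Real.logb 2 (4 * Real.sqrt d / α)⌉₊) (((2 : ℝ) ^ d)⁻¹ * η) := by
  obtain ⟨R, hR⟩ := hbdd
  obtain ⟨M, hM⟩ := pow_unbounded_of_one_lt R (one_lt_two (α := ℝ))
  set ρ : ℝ := (1 / 4) * (2 ^ M)⁻¹ with hρdef
  have hρ : 0 < ρ := by positivity
  have hρR : ρ * R ≤ 1 / 4 := by
    rw [hρdef, mul_assoc, inv_mul_eq_div]
    have := (div_le_one (by positivity : (0 : ℝ) < 2 ^ M)).mpr hM.le
    linarith
  have hae : ∀ᵐ t ∂(uniformCube d), ∀ m : ℕ, ∀ᵐ x ∂μ, ((2 : ℝ) ^ d)⁻¹ * η ≤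
      liminf (fun n : ℕ => ({i : ℕ | i < n ∧
        (x ∈ porousPoints μ α ((2 : ℝ) ^ (-(i : ℝ))) (1 / ((m : ℝ) + 1)) ∧
        t ∈ univ.pi fun j => dyadicMiddle (ρ * x j) (i + M))}.ncard : ℝ) / n) atTop :=
    ae_all_iff.mpr fun m =>
      ae_uniformCube_ae_le_liminf hα hη (hpor _ Nat.one_div_pos_of_nat) ρ M
  obtain ⟨t, htmid, ht⟩ :=
    ((frequently_ae_mem_iff.mpr (uniformCube_middle_ne_zero d)).and_eventually hae).exists
  have hemb := measurableEmbedding_smul_add hρ.ne' (WithLp.toLp 2 t)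
  refine ⟨ρ, hρ, WithLp.toLp 2 t, ?_, fun ε hε => ?_⟩
  · rw [hemb.map_apply]
    refine le_antisymm prob_le_one (hR.symm.le.trans (measure_mono fun x hx => ?_))
    exact smul_add_toLp_mem_unitCube hρ hρR htmid hx
  · obtain ⟨m, hm⟩ := exists_nat_one_div_lt hε
    rw [DyadicMeanPorousWith, hemb.ae_map_iff]
    filter_upwards [ht m] with x hx
    refine le_liminf_ncard_of_shift M (fun i hi => ?_) hx
    refine por2Le_mono hm.le (por2Le_map_of_mem_porousPoints hd hρ ?_
      (one_le_ceil_logb hd hα hα') (four_mul_sqrt_le_mul_two_pow_ceil hd hα) hi.1 fun j => ?_)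
    · rw [hρdef, Real.rpow_neg zero_le_two, Real.rpow_natCast, pow_add]
      field_simp
    · exact hi.2 j (mem_univ j)
end

section
/- Let μ be a Borel probability measure on [0,1)^d with dim_P(μ) < d. Then there exist η ∈ (0,1) and ε ∈ (0, 2^{-d}) such that μ is dyadic mean (1,η,ε)-porous. -/
open MeasureTheory Filter Metric Set
open scoped ENNReal NNReal

/-- The upper local dimension of a measure at a point:
`limsup_{r→0⁺} log μ(B(x,r)) / log r` (closed balls), as an extended real. -/
noncomputable def upperLocalDim {d : ℕ} (μ : Measure (EuclideanSpace ℝ (Fin d)))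
    (x : EuclideanSpace ℝ (Fin d)) : EReal :=
  Filter.limsup
    (fun r : ℝ => ((Real.log ((μ (Metric.closedBall x r)).toReal) / Real.log r : ℝ) : EReal))
    (nhdsWithin (0 : ℝ) (Set.Ioi 0))

/-- The (upper) packing dimension of a measure: the `μ`-essential supremum of the
upper local dimensions. -/
noncomputable def packingDim {d : ℕ} (μ : Measure (EuclideanSpace ℝ (Fin d))) : EReal :=
  essSup (fun x => upperLocalDim μ x) μ

/-- The integer index of the dyadic cube of level `n` containing `x`. -/
noncomputable def dyadicIndex (d n : ℕ) (x : EuclideanSpace ℝ (Fin d)) : Fin d → ℤ :=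
  fun j => ⌊(2 : ℝ) ^ n * x j⌋

theorem dyadicCube_eq_preimage (d n : ℕ) (x : EuclideanSpace ℝ (Fin d)) :
    dyadicCube d n x = dyadicIndex d n ⁻¹' {dyadicIndex d n x} := by
  ext y
  simp [dyadicCube, dyadicIndex, funext_iff]

theorem measurable_dyadicIndex (d n : ℕ) : Measurable (dyadicIndex d n) := by
  refine measurable_pi_lambda _ fun j => Int.measurable_floor.comp ?_
  fun_prop

theorem exists_dyadicIndex_eq (d n : ℕ) (k : Fin d → ℤ) : ∃ y, dyadicIndex d n y = k := by
  refine ⟨WithLp.toLp 2 fun j => (k j : ℝ) / 2 ^ n, ?_⟩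
  ext j
  simp [dyadicIndex, mul_div_cancel₀]

theorem dyadicIndex_eq_ediv_two (d n : ℕ) (x : EuclideanSpace ℝ (Fin d)) (j : Fin d) :
    dyadicIndex d n x j = dyadicIndex d (n + 1) x j / 2 := by
  have h : (2 : ℝ) ^ n * x j = (2 : ℝ) ^ (n + 1) * x j / (2 : ℕ) := by
    push_cast; ring
  simp only [dyadicIndex, h, Int.floor_div_natCast]
  norm_num

/-- The indices of the subcubes one level below the cube of index `k`. -/
def childIndices {d : ℕ} (k : Fin d → ℤ) : Finset (Fin d → ℤ) :=
  Fintype.piFinset fun j => {2 * k j, 2 * k j + 1}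

theorem card_childIndices {d : ℕ} (k : Fin d → ℤ) : (childIndices k).card = 2 ^ d := by
  simp [childIndices]

theorem mem_childIndices_iff {d n : ℕ} (k : Fin d → ℤ) (y : EuclideanSpace ℝ (Fin d)) :
    dyadicIndex d (n + 1) y ∈ childIndices k ↔ dyadicIndex d n y = k := by
  simp only [childIndices, Fintype.mem_piFinset, Finset.mem_insert, Finset.mem_singleton,
    funext_iff, dyadicIndex_eq_ediv_two d n y]
  exact forall_congr' fun j => by omega

theorem sum_childIndices {d : ℕ} (μ : Measure (EuclideanSpace ℝ (Fin d))) [IsFiniteMeasure μ]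
    (n : ℕ) (x : EuclideanSpace ℝ (Fin d)) :
    ∑ k ∈ childIndices (dyadicIndex d n x), μ.real (dyadicIndex d (n + 1) ⁻¹' {k}) =
      μ.real (dyadicCube d n x) := by
  have h : dyadicCube d n x =
      dyadicIndex d (n + 1) ⁻¹' ↑(childIndices (dyadicIndex d n x)) := by
    ext y
    simp [dyadicCube_eq_preimage, mem_childIndices_iff]
  rw [h, sum_measureReal_preimage_singleton _
    fun k _ => measurable_dyadicIndex d (n + 1) (measurableSet_singleton k)]

/-- At a level that is not porous, no subcube carries much more than its share of the mass. -/
theorem measureReal_dyadicCube_succ_le_of_not_por2Le {d : ℕ}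
    (μ : Measure (EuclideanSpace ℝ (Fin d))) [IsFiniteMeasure μ]
    (x : EuclideanSpace ℝ (Fin d)) (n : ℕ) {ε : ℝ} (hε : 0 ≤ ε) (h : ¬ por2Le μ x n 1 ε) :
    μ.real (dyadicCube d (n + 1) x) ≤ (1 - (2 ^ d - 1) * ε) * μ.real (dyadicCube d n x) := by
  have hx : dyadicIndex d (n + 1) x ∈ childIndices (dyadicIndex d n x) := by
    simp [mem_childIndices_iff]
  have hchild : ∀ k ∈ (childIndices (dyadicIndex d n x)).erase (dyadicIndex d (n + 1) x),
      ε * μ.real (dyadicCube d n x) ≤ μ.real (dyadicIndex d (n + 1) ⁻¹' {k}) := by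
    intro k hk
    obtain ⟨y, rfl⟩ := exists_dyadicIndex_eq d (n + 1) k
    by_contra! hlt
    refine h ⟨1, le_rfl, le_rfl, y, ?_, ?_⟩
    · rw [dyadicCube_eq_preimage]
      exact (mem_childIndices_iff _ y).1 (Finset.mem_of_mem_erase hk)
    · rw [dyadicCube_eq_preimage d (n + 1) y, ← ofReal_measureReal,
        ← ofReal_measureReal (s := dyadicCube d n x), ← ENNReal.ofReal_mul hε]
      exact ENNReal.ofReal_le_ofReal hlt.le
  have hsum := Finset.card_nsmul_le_sum _ _ _ hchild
  have htot := sum_childIndices μ n x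
  rw [← Finset.add_sum_erase _ _ hx, ← dyadicCube_eq_preimage] at htot
  rw [Finset.card_erase_of_mem hx, card_childIndices, nsmul_eq_mul,
    Nat.cast_sub Nat.one_le_two_pow] at hsum
  push_cast at hsum
  linarith

theorem dyadicCube_succ_subset (d n : ℕ) (x : EuclideanSpace ℝ (Fin d)) :
    dyadicCube d (n + 1) x ⊆ dyadicCube d n x := by
  intro y hy
  simp only [dyadicCube_eq_preimage, mem_preimage, mem_singleton_iff] at hy ⊢
  ext j
  rw [dyadicIndex_eq_ediv_two d n y, hy, ← dyadicIndex_eq_ediv_two]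

theorem ncard_por2Le_succ {d : ℕ} (μ : Measure (EuclideanSpace ℝ (Fin d)))
    (x : EuclideanSpace ℝ (Fin d)) (n : ℕ) (ε : ℝ) [Decidable (por2Le μ x n 1 ε)] :
    {i : ℕ | i < n + 1 ∧ por2Le μ x i 1 ε}.ncard =
      {i : ℕ | i < n ∧ por2Le μ x i 1 ε}.ncard + if por2Le μ x n 1 ε then 1 else 0 := by
  have hfin : {i : ℕ | i < n ∧ por2Le μ x i 1 ε}.Finite :=
    (finite_Iio n).subset fun i hi => hi.1
  split_ifs with h
  · rw [← ncard_insert_of_notMem (a := n) (by simp) hfin]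
    congr 1
    ext i
    simp only [mem_ofPred_eq, mem_insert_iff, Nat.lt_succ_iff_lt_or_eq]
    aesop
  · rw [add_zero]
    congr 1
    ext i
    simp only [mem_ofPred_eq, Nat.lt_succ_iff_lt_or_eq]
    aesop

theorem ncard_por2Le_le {d : ℕ} (μ : Measure (EuclideanSpace ℝ (Fin d)))
    (x : EuclideanSpace ℝ (Fin d)) (n : ℕ) (ε : ℝ) :
    {i : ℕ | i < n ∧ por2Le μ x i 1 ε}.ncard ≤ n := by
  have h : {i : ℕ | i < n ∧ por2Le μ x i 1 ε}.ncard ≤ (Iio n).ncard :=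
    ncard_le_ncard (fun i hi => hi.1) (finite_Iio n)
  rwa [ncard_eq_toFinset_card' (Iio n), toFinset_Iio, Nat.card_Iio] at h

theorem measureReal_dyadicCube_le_pow {d : ℕ}
    (μ : Measure (EuclideanSpace ℝ (Fin d))) [IsProbabilityMeasure μ]
    (x : EuclideanSpace ℝ (Fin d)) {ε : ℝ} (hε : 0 ≤ ε) (hβ : 0 ≤ 1 - (2 ^ d - 1) * ε) (n : ℕ) :
    μ.real (dyadicCube d n x) ≤
      (1 - (2 ^ d - 1) * ε) ^ (n - {i : ℕ | i < n ∧ por2Le μ x i 1 ε}.ncard) := by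
  classical
  induction n with
  | zero => simp
  | succ n ih =>
    rw [ncard_por2Le_succ]
    split_ifs with h
    · rw [Nat.add_sub_add_right]
      exact (measureReal_mono (dyadicCube_succ_subset d n x)).trans ih
    · rw [add_zero, Nat.succ_sub (ncard_por2Le_le μ x n ε), pow_succ']
      exact (measureReal_dyadicCube_succ_le_of_not_por2Le μ x n hε h).trans
        (mul_le_mul_of_nonneg_left ih hβ)

/-- The integer vectors with all entries in `{-1, 0, 1}`. -/
noncomputable def unitOffsets (d : ℕ) : Finset (Fin d → ℤ) :=
  Fintype.piFinset fun _ => Finset.Icc (-1) 1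

theorem closedBall_subset_dyadicIndex_preimage (d n : ℕ) (x : EuclideanSpace ℝ (Fin d)) :
    closedBall x ((2 : ℝ) ^ n)⁻¹ ⊆
      ⋃ v ∈ unitOffsets d, dyadicIndex d n ⁻¹' {dyadicIndex d n x + v} := by
  intro y hy
  refine mem_iUnion₂.2 ⟨dyadicIndex d n y - dyadicIndex d n x, ?_, by simp⟩
  simp only [unitOffsets, Fintype.mem_piFinset, Finset.mem_Icc, Pi.sub_apply, dyadicIndex]
  intro j
  have hj : |y j - x j| ≤ ((2 : ℝ) ^ n)⁻¹ := by
    have h := (PiLp.norm_apply_le (y - x) j).trans (mem_closedBall_iff_norm.1 hy)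
    simpa using h
  have hpos : (0 : ℝ) < 2 ^ n := by positivity
  have hscale : |2 ^ n * y j - 2 ^ n * x j| ≤ 1 := by
    rw [← mul_sub, abs_mul, abs_of_pos hpos]
    calc _ ≤ 2 ^ n * ((2 : ℝ) ^ n)⁻¹ := by gcongr
      _ = 1 := mul_inv_cancel₀ hpos.ne'
  obtain ⟨h1, h2⟩ := abs_le.1 hscale
  have hyx : ⌊2 ^ n * y j⌋ ≤ ⌊2 ^ n * x j⌋ + 1 := by
    rw [← Int.floor_add_one]
    exact Int.floor_le_floor (by linarith)
  have hxy : ⌊2 ^ n * x j⌋ ≤ ⌊2 ^ n * y j⌋ + 1 := by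
    rw [← Int.floor_add_one]
    exact Int.floor_le_floor (by linarith)
  constructor <;> linarith

/-- The set of indices whose mass is a small fraction of the mass of the neighbours is small. -/
theorem measure_setOf_le_mul_sum_translates {G : Type*} [AddGroup G] [Countable G]
    [MeasurableSpace G] [MeasurableSingletonClass G] (ν : Measure G) (V : Finset G) (c : ℝ≥0∞) :
    ν {k | ν {k} ≤ c * ∑ v ∈ V, ν {k + v}} ≤ c * (V.card * ν univ) := by
  set K := {k | ν {k} ≤ c * ∑ v ∈ V, ν {k + v}}
  have htot : ∑' k, ν {k} = ν univ := by
    rw [← tsum_univ fun k => ν {k}]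
    exact tsum_measure_preimage_singleton (μ := ν) (f := id) countable_univ
      fun k _ => measurableSet_singleton k
  calc ν K = ν (⋃ k : K, {(k : G)}) := by simp
    _ ≤ ∑' k : K, ν {(k : G)} := measure_iUnion_le _
    _ ≤ ∑' k : K, c * ∑ v ∈ V, ν {(k : G) + v} := ENNReal.tsum_le_tsum fun k => k.2
    _ ≤ ∑' k : G, c * ∑ v ∈ V, ν {k + v} :=
      ENNReal.tsum_comp_le_tsum_of_injective Subtype.val_injective _
    _ = c * ∑ v ∈ V, ∑' k : G, ν {k + v} := by
      rw [ENNReal.tsum_mul_left, Summable.tsum_finsetSum fun _ _ => ENNReal.summable]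
    _ = c * (V.card * ν univ) := by
      congr 1
      rw [← nsmul_eq_mul, ← Finset.sum_const]
      refine Finset.sum_congr rfl fun v _ => ?_
      rw [← htot]
      exact (Equiv.addRight v).tsum_eq fun k => ν {k}

theorem measure_setOf_dyadicCube_le_mul_closedBall {d : ℕ}
    (μ : Measure (EuclideanSpace ℝ (Fin d))) [IsProbabilityMeasure μ] (n : ℕ) (c : ℝ≥0∞) :
    μ {x | μ (dyadicCube d n x) ≤ c * μ (closedBall x ((2 : ℝ) ^ n)⁻¹)} ≤
      c * (unitOffsets d).card := by
  set ν := μ.map (dyadicIndex d n)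
  have hν : ∀ k, ν {k} = μ (dyadicIndex d n ⁻¹' {k}) := fun k =>
    Measure.map_apply (measurable_dyadicIndex d n) (measurableSet_singleton k)
  have : IsProbabilityMeasure ν :=
    Measure.isProbabilityMeasure_map (measurable_dyadicIndex d n).aemeasurable
  set K := {k | ν {k} ≤ c * ∑ v ∈ unitOffsets d, ν {k + v}}
  calc _ ≤ μ (dyadicIndex d n ⁻¹' K) := by
        refine measure_mono fun x hx => ?_
        simp only [K, mem_preimage, mem_ofPred_eq, hν]
        rw [← dyadicCube_eq_preimage]
        refine le_trans hx ?_
        gcongr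
        exact (measure_mono (closedBall_subset_dyadicIndex_preimage d n x)).trans
          (measure_biUnion_finset_le _ _)
    _ = ν K := (Measure.map_apply (measurable_dyadicIndex d n) (to_countable K).measurableSet).symm
    _ ≤ _ := by
      simpa using measure_setOf_le_mul_sum_translates ν (unitOffsets d) c

/-- Almost surely, dyadic cubes are not much lighter than balls of comparable size. -/
theorem ae_eventually_pow_mul_closedBall_lt_dyadicCube {d : ℕ}
    (μ : Measure (EuclideanSpace ℝ (Fin d))) [IsProbabilityMeasure μ] {q : ℝ≥0∞} (hq : q < 1) :
    ∀ᵐ x ∂μ, ∀ᶠ n : ℕ in atTop,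
      q ^ n * μ (closedBall x ((2 : ℝ) ^ n)⁻¹) < μ (dyadicCube d n x) := by
  have hsum : ∑' n : ℕ, μ {x | μ (dyadicCube d n x) ≤
      q ^ n * μ (closedBall x ((2 : ℝ) ^ n)⁻¹)} ≠ ∞ := by
    refine ne_top_of_le_ne_top ?_ (ENNReal.tsum_le_tsum fun n =>
      measure_setOf_dyadicCube_le_mul_closedBall μ n (q ^ n))
    rw [ENNReal.tsum_mul_right, ENNReal.tsum_geometric]
    refine ENNReal.mul_ne_top (ENNReal.inv_ne_top.2 ?_) (ENNReal.natCast_ne_top _)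
    exact (tsub_pos_of_lt hq).ne'
  filter_upwards [ae_eventually_notMem hsum] with x hx
  filter_upwards [hx] with n hn
  simpa using hn

theorem ae_eventually_rpow_lt_dyadicCube {d : ℕ}
    (μ : Measure (EuclideanSpace ℝ (Fin d))) [IsProbabilityMeasure μ] {s t : ℝ} (hst : s < t)
    (hdim : packingDim μ < (s : EReal)) :
    ∀ᵐ x ∂μ, ∀ᶠ n : ℕ in atTop, ((2 : ℝ) ^ (-t)) ^ n < μ.real (dyadicCube d n x) := by
  have hq : ENNReal.ofReal ((2 : ℝ) ^ (-(t - s))) < 1 := by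
    rw [ENNReal.ofReal_lt_one]
    exact Real.rpow_lt_one_of_one_lt_of_neg one_lt_two (by linarith)
  filter_upwards [ae_eventually_pow_mul_closedBall_lt_dyadicCube μ hq, ae_lt_of_essSup_lt hdim,
    Measure.support_mem_ae (μ := μ)] with x hx hloc hsupp
  have hlim : Tendsto (fun n : ℕ => ((2 : ℝ) ^ n)⁻¹) atTop (nhdsWithin 0 (Ioi 0)) := by
    refine tendsto_nhdsWithin_iff.2 ⟨?_, Eventually.of_forall fun n => ?_⟩
    · exact (tendsto_pow_atTop_atTop_of_one_lt one_lt_two).inv_tendsto_atTop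
    · exact mem_Ioi.2 (by positivity)
  filter_upwards [hx, hlim.eventually (eventually_lt_of_limsup_lt hloc), eventually_ge_atTop 1]
    with n hn hball hn1
  set m := μ.real (closedBall x ((2 : ℝ) ^ n)⁻¹) with hm
  have hmpos : 0 < m := by
    refine ENNReal.toReal_pos ?_ (measure_ne_top _ _)
    exact ((Measure.mem_support_iff_forall x).1 hsupp _
      (closedBall_mem_nhds x (by positivity))).ne'
  have hlow : ((2 : ℝ) ^ (-s)) ^ n < m := by
    have hlog : Real.log ((2 : ℝ) ^ n)⁻¹ = -(n * Real.log 2) := by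
      rw [Real.log_inv, Real.log_pow]
    have hneg : -(n * Real.log 2) < 0 := by
      have : (0 : ℝ) < n := by exact_mod_cast hn1
      have := Real.log_pos one_lt_two
      nlinarith
    have hball' : Real.log m / -(n * Real.log 2) < s := by
      rw [← hlog]
      exact EReal.coe_lt_coe_iff.1 hball
    rw [div_lt_iff_of_neg hneg] at hball'
    rw [← Real.log_lt_log_iff (by positivity) hmpos, Real.log_pow, Real.log_rpow two_pos]
    linarith
  have hn' : ((2 : ℝ) ^ (-(t - s))) ^ n * m < μ.real (dyadicCube d n x) := by
    have h := (ENNReal.toReal_lt_toReal (ne_top_of_lt hn) (measure_ne_top _ _)).2 hn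
    rwa [ENNReal.toReal_mul, ENNReal.toReal_pow, ENNReal.toReal_ofReal (by positivity)] at h
  calc ((2 : ℝ) ^ (-t)) ^ n = ((2 : ℝ) ^ (-(t - s))) ^ n * ((2 : ℝ) ^ (-s)) ^ n := by
        rw [← mul_pow, ← Real.rpow_add two_pos]
        ring_nf
    _ < ((2 : ℝ) ^ (-(t - s))) ^ n * m := by gcongr
    _ < _ := hn'

theorem exists_rpow_lt_two_rpow_neg {d : ℕ} {t : ℝ} (ht : t < d) :
    ∃ δ ∈ Ioo (0 : ℝ) ((2 : ℝ) ^ d)⁻¹,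
      (1 - (2 ^ d - 1) * (((2 : ℝ) ^ d)⁻¹ - δ)) ^ (1 - δ) < (2 : ℝ) ^ (-t) := by
  have hpos : (0 : ℝ) < 2 ^ d := by positivity
  have hbase : 1 - (2 ^ d - 1) * (((2 : ℝ) ^ d)⁻¹ - 0) = ((2 : ℝ) ^ d)⁻¹ := by
    field_simp
    ring
  have hcont : ContinuousAt (fun δ : ℝ =>
      (1 - (2 ^ d - 1) * (((2 : ℝ) ^ d)⁻¹ - δ)) ^ (1 - δ)) 0 := by
    refine ContinuousAt.rpow (by fun_prop) (by fun_prop) (Or.inl ?_)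
    rw [hbase]
    positivity
  have hlt : (1 - (2 ^ d - 1) * (((2 : ℝ) ^ d)⁻¹ - 0)) ^ (1 - (0 : ℝ)) < (2 : ℝ) ^ (-t) := by
    rw [hbase, sub_zero, Real.rpow_one, ← Real.rpow_natCast, ← Real.rpow_neg two_pos.le]
    exact Real.rpow_lt_rpow_of_exponent_lt one_lt_two (by linarith)
  have hev := (hcont.eventually_lt continuousAt_const hlt).filter_mono
    (nhdsWithin_le_nhds (s := Ioi 0))
  obtain ⟨δ, h1, h2⟩ := (hev.and (Ioo_mem_nhdsGT (inv_pos.2 hpos))).exists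
  exact ⟨δ, h2, h1⟩

/-- If `μ` is a Borel probability measure on `[0,1)^d` with
`dim_P(μ) < d`, then there are `η ∈ (0,1)` and `ε ∈ (0, 2^{-d})` such that `μ` is
dyadic mean `(1,η,ε)`-porous. -/
theorem dyadicMeanPorous_of_packingDim_lt (d : ℕ) (hd : 1 ≤ d)
    (μ : Measure (EuclideanSpace ℝ (Fin d))) [IsProbabilityMeasure μ]
    (hsupp : μ (unitCube d) = 1)
    (hdim : packingDim μ < ((d : ℝ) : EReal)) :
    ∃ η ∈ Set.Ioo (0 : ℝ) 1, ∃ ε ∈ Set.Ioo (0 : ℝ) ((2 : ℝ) ^ d)⁻¹,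
      DyadicMeanPorousWith μ 1 η ε := by
  obtain ⟨s, hs, hsd⟩ := EReal.lt_iff_exists_real_btwn.1 hdim
  obtain ⟨t, hst, htd⟩ := exists_between (EReal.coe_lt_coe_iff.1 hsd)
  obtain ⟨δ, ⟨hδ0, hδ1⟩, hδ⟩ := exists_rpow_lt_two_rpow_neg htd
  have hpow : (2 : ℝ) ≤ 2 ^ d := le_self_pow₀ one_le_two (by omega)
  have hinv : ((2 : ℝ) ^ d)⁻¹ < 1 := inv_lt_one_of_one_lt₀ (by linarith)
  set ε := ((2 : ℝ) ^ d)⁻¹ - δ with hε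
  set β := 1 - (2 ^ d - 1) * ε with hβ
  have hε0 : 0 < ε := sub_pos.2 hδ1
  have hmul : (2 ^ d - 1) * ε < 1 := by
    have h : (2 : ℝ) ^ d * ((2 : ℝ) ^ d)⁻¹ = 1 := mul_inv_cancel₀ (by positivity)
    nlinarith
  have hβ0 : 0 < β := sub_pos.2 hmul
  have hβ1 : β ≤ 1 := by
    have : 0 ≤ (2 ^ d - 1) * ε := mul_nonneg (by linarith) hε0.le
    linarith
  refine ⟨δ, ⟨hδ0, hδ1.trans hinv⟩, ε, ⟨hε0, by linarith⟩, ?_⟩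
  filter_upwards [ae_eventually_rpow_lt_dyadicCube μ hst hs] with x hx
  refine le_liminf_of_le (IsBoundedUnder.isCoboundedUnder_ge ⟨1, ?_⟩) ?_
  · refine eventually_map.2 (Eventually.of_forall fun n => ?_)
    exact div_le_one_of_le₀ (by exact_mod_cast ncard_por2Le_le μ x n ε) n.cast_nonneg
  filter_upwards [hx, eventually_ge_atTop 1] with n hn hn1
  by_contra! hlt
  have hn0 : (0 : ℝ) < n := by exact_mod_cast hn1
  rw [div_lt_iff₀ hn0] at hlt
  have hle : β ^ (n - {i : ℕ | i < n ∧ por2Le μ x i 1 ε}.ncard) ≤ (β ^ (1 - δ)) ^ n := by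
    rw [← Real.rpow_natCast, ← Real.rpow_mul_natCast hβ0.le,
      Nat.cast_sub (ncard_por2Le_le μ x n ε)]
    exact Real.rpow_le_rpow_of_exponent_ge hβ0 hβ1 (by linarith)
  have hcube := measureReal_dyadicCube_le_pow μ x hε0.le hβ0.le n
  have hcmp : (β ^ (1 - δ)) ^ n ≤ ((2 : ℝ) ^ (-t)) ^ n := by gcongr
  linarith
end

section
/- Let d ≥ 1, 0 < α ≤ 1/2 and 0 < η ≤ 1. Let μ be a Borel probability measure on ℝ^d such that for μ-almost every x there exists r(x) ∈ (0,1] with the property that for every ε > 0, liminf_{n→∞} (1/n)·#{i ∈ {0,…,n−1} : por(μ,x,r(x)·2^{-i},ε) ≥ α} ≥ η. Then dim_P(μ) ≤ d − c_d·η·α^d, where c_d = 2/(5·log 2·2^{4d}·d^{d/2}). -/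
open MeasureTheory Filter Metric Set
open scoped ENNReal NNReal

section Tree

variable {ι : Type*}

/-- The indicator of the nodes at level `n` having a descendant at level `n + j` in `Sel`. -/
noncomputable def coverInd (par : ι → ι) (Sel : ℕ → Set ι) (j n : ℕ) (z : ι) : ℝ :=
  Set.indicator (par^[j] '' Sel (n + j)) 1 z

lemma coverInd_nonneg (par : ι → ι) (Sel : ℕ → Set ι) (j n : ℕ) (z : ι) :
    0 ≤ coverInd par Sel j n z :=
  Set.indicator_nonneg (fun _ _ => zero_le_one) _

lemma coverInd_le_one (par : ι → ι) (Sel : ℕ → Set ι) (j n : ℕ) (z : ι) :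
    coverInd par Sel j n z ≤ 1 :=
  Set.indicator_le_self' (fun _ _ => zero_le_one) _

lemma coverInd_succ_le_sum {par : ι → ι} {ch : ι → Finset ι}
    (hch : ∀ z z', z' ∈ ch z ↔ par z' = z) (Sel : ℕ → Set ι) (j n : ℕ) (z : ι) :
    coverInd par Sel (j + 1) n z ≤ ∑ z' ∈ ch z, coverInd par Sel j (n + 1) z' := by
  by_cases hz : z ∈ par^[j + 1] '' Sel (n + (j + 1))
  · obtain ⟨w, hw, hwz⟩ := hz
    have h1 : par^[j] w ∈ ch z := by
      rw [hch, ← Function.iterate_succ_apply' par j w]; exact hwz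
    have h2 : coverInd par Sel j (n + 1) (par^[j] w) = 1 := by
      have hw' : w ∈ Sel (n + 1 + j) := by
        rwa [show n + 1 + j = n + (j + 1) by ring]
      simp only [coverInd]
      rw [Set.indicator_of_mem (mem_image_of_mem _ hw')]
      rfl
    calc coverInd par Sel (j + 1) n z ≤ 1 := coverInd_le_one ..
      _ = coverInd par Sel j (n + 1) (par^[j] w) := h2.symm
      _ ≤ _ := Finset.single_le_sum (f := fun z' => coverInd par Sel j (n + 1) z')
        (fun i _ => coverInd_nonneg par Sel j (n + 1) i) h1
  · have : coverInd par Sel (j + 1) n z = 0 := Set.indicator_of_notMem hz _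
    rw [this]
    exact Finset.sum_nonneg fun i _ => coverInd_nonneg ..

/-- The density, relative to the uniform weight on the tree, which gains a factor `exp s` at
each node having a selected descendant `p` levels below, and loses a factor `2 ^ p` at each
selected node. -/
noncomputable def treeWeight (par : ι → ι) (Sel : ℕ → Set ι) (p : ℕ) (s : ℝ) : ℕ → ι → ℝ
  | 0, _ => 1
  | n + 1, z => treeWeight par Sel p s n (par z) *
      Real.exp (s * coverInd par Sel p n (par z)) * (1 / 2 ^ p) ^ coverInd par Sel 0 (n + 1) z

lemma treeWeight_pos (par : ι → ι) (Sel : ℕ → Set ι) (p : ℕ) (s : ℝ) (n : ℕ) (z : ι) :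
    0 < treeWeight par Sel p s n z := by
  induction n generalizing z with
  | zero => exact one_pos
  | succ n ih =>
    have := ih (par z)
    rw [treeWeight]
    positivity

/-- The correction term accounting for the selected descendants fewer than `p` levels below. -/
noncomputable def treePotential (par : ι → ι) (Sel : ℕ → Set ι) (p : ℕ) (q : ℝ) (n : ℕ)
    (z : ι) : ℝ :=
  2 - ∑ j ∈ Finset.range (p - 1), q ^ (j + 1) * coverInd par Sel (j + 1) n z

lemma sum_pow_coverInd_le (par : ι → ι) (Sel : ℕ → Set ι) (p : ℕ) {q : ℝ} (hq : 0 ≤ q)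
    (hq' : q ≤ 1 / 2) (n : ℕ) (z : ι) :
    ∑ j ∈ Finset.range p, q ^ (j + 1) * coverInd par Sel (j + 1) n z ≤ 1 - 1 / 2 ^ p := by
  have h : ∑ j ∈ Finset.range p, ((1 : ℝ) / 2) ^ (j + 1) = 1 - 1 / 2 ^ p := by
    induction p with
    | zero => simp
    | succ p ih => rw [Finset.sum_range_succ, ih, one_div_pow]; field_simp; ring
  rw [← h]
  refine Finset.sum_le_sum fun j _ => ?_
  calc q ^ (j + 1) * coverInd par Sel (j + 1) n z ≤ q ^ (j + 1) * 1 := by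
        gcongr; exact coverInd_le_one ..
    _ ≤ _ := by rw [mul_one]; gcongr

lemma treePotential_le_two (par : ι → ι) (Sel : ℕ → Set ι) (p : ℕ) {q : ℝ} (hq : 0 ≤ q)
    (n : ℕ) (z : ι) : treePotential par Sel p q n z ≤ 2 := by
  have : 0 ≤ ∑ j ∈ Finset.range (p - 1), q ^ (j + 1) * coverInd par Sel (j + 1) n z :=
    Finset.sum_nonneg fun j _ => mul_nonneg (by positivity) (coverInd_nonneg ..)
  rw [treePotential]; linarith

lemma one_add_le_treePotential (par : ι → ι) (Sel : ℕ → Set ι) (p : ℕ) {q : ℝ} (hq : 0 ≤ q)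
    (hq' : q ≤ 1 / 2) (n : ℕ) (z : ι) :
    1 + 1 / 2 ^ (p - 1) ≤ treePotential par Sel p q n z := by
  have := sum_pow_coverInd_le par Sel (p - 1) hq hq' n z
  rw [treePotential]; linarith

lemma rpow_coverInd_mul_treePotential_le (par : ι → ι) (Sel : ℕ → Set ι) {p : ℕ} (hp : 1 ≤ p)
    {q : ℝ} (hq : 0 ≤ q) (hq' : q ≤ 1 / 2) (n : ℕ) (z : ι) :
    (1 / 2 ^ p : ℝ) ^ coverInd par Sel 0 n z * treePotential par Sel p q n z ≤
      2 - ∑ j ∈ Finset.range p, q ^ j * coverInd par Sel j n z := by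
  have h0 : 2 - ∑ j ∈ Finset.range p, q ^ j * coverInd par Sel j n z =
      treePotential par Sel p q n z - coverInd par Sel 0 n z := by
    obtain ⟨m, rfl⟩ : ∃ m, p = m + 1 := ⟨p - 1, by omega⟩
    rw [Finset.sum_range_succ', treePotential]
    simp only [pow_zero, one_mul, add_tsub_cancel_right]
    ring
  rw [h0]
  have h1 := one_add_le_treePotential par Sel p hq hq' n z
  have h2 := treePotential_le_two par Sel p hq n z
  by_cases hz : z ∈ par^[0] '' Sel (n + 0)
  · have : coverInd par Sel 0 n z = 1 := by
      simp only [coverInd]; rw [Set.indicator_of_mem hz]; rfl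
    rw [this, Real.rpow_one]
    have h3 : (1 : ℝ) / 2 ^ (p - 1) = 2 * (1 / 2 ^ p) := by
      obtain ⟨m, rfl⟩ : ∃ m, p = m + 1 := ⟨p - 1, by omega⟩
      simp only [add_tsub_cancel_right]; field_simp; ring
    have h4 : (0 : ℝ) < 1 / 2 ^ p := by positivity
    nlinarith
  · have : coverInd par Sel 0 n z = 0 := Set.indicator_of_notMem hz _
    rw [this]; simp

lemma sum_rpow_coverInd_mul_treePotential_le {par : ι → ι} {ch : ι → Finset ι}
    (hch : ∀ z z', z' ∈ ch z ↔ par z' = z) {b : ℕ} (hcard : ∀ z, (ch z).card = b) (hb : 2 ≤ b)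
    (Sel : ℕ → Set ι) {p : ℕ} (hp : 1 ≤ p) (n : ℕ) (z : ι) :
    ∑ z' ∈ ch z, (1 / 2 ^ p : ℝ) ^ coverInd par Sel 0 (n + 1) z' *
        treePotential par Sel p (b : ℝ)⁻¹ (n + 1) z' ≤
      b * (treePotential par Sel p (b : ℝ)⁻¹ n z - (b : ℝ)⁻¹ ^ p * coverInd par Sel p n z) := by
  have hb0 : (0 : ℝ) < b := by positivity
  have hq : (0 : ℝ) ≤ (b : ℝ)⁻¹ := by positivity
  have hq' : (b : ℝ)⁻¹ ≤ 1 / 2 := by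
    rw [one_div]; apply inv_anti₀ two_pos; exact_mod_cast hb
  calc _ ≤ ∑ z' ∈ ch z, (2 - ∑ j ∈ Finset.range p, (b : ℝ)⁻¹ ^ j * coverInd par Sel j (n + 1) z') :=
        Finset.sum_le_sum fun z' _ => rpow_coverInd_mul_treePotential_le par Sel hp hq hq' _ _
    _ = b * 2 - ∑ j ∈ Finset.range p, (b : ℝ)⁻¹ ^ j *
          ∑ z' ∈ ch z, coverInd par Sel j (n + 1) z' := by
        rw [Finset.sum_sub_distrib, Finset.sum_comm]
        simp [hcard, Finset.mul_sum]
    _ ≤ b * 2 - ∑ j ∈ Finset.range p, (b : ℝ)⁻¹ ^ j * coverInd par Sel (j + 1) n z := by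
        gcongr with j
        exact coverInd_succ_le_sum hch Sel j n z
    _ = b * (2 - ∑ j ∈ Finset.range p, (b : ℝ)⁻¹ ^ (j + 1) * coverInd par Sel (j + 1) n z) := by
        rw [mul_sub, Finset.mul_sum]
        congr 1
        refine Finset.sum_congr rfl fun j _ => ?_
        rw [pow_succ]; field_simp
    _ = _ := by
        obtain ⟨m, rfl⟩ : ∃ m, p = m + 1 := ⟨p - 1, by omega⟩
        rw [treePotential, Finset.sum_range_succ]
        simp only [add_tsub_cancel_right]
        ring

/-- The supermartingale property of `treeWeight * treePotential`. -/
lemma sum_treeWeight_mul_treePotential_le {par : ι → ι} {ch : ι → Finset ι}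
    (hch : ∀ z z', z' ∈ ch z ↔ par z' = z) {b : ℕ} (hcard : ∀ z, (ch z).card = b) (hb : 2 ≤ b)
    (Sel : ℕ → Set ι) {p : ℕ} (hp : 1 ≤ p) (n : ℕ) (z : ι) :
    ∑ z' ∈ ch z, treeWeight par Sel p ((b : ℝ)⁻¹ ^ p / 2) (n + 1) z' *
        treePotential par Sel p (b : ℝ)⁻¹ (n + 1) z' ≤
      b * (treeWeight par Sel p ((b : ℝ)⁻¹ ^ p / 2) n z *
        treePotential par Sel p (b : ℝ)⁻¹ n z) := by
  have hb0 : (0 : ℝ) < b := by positivity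
  set s : ℝ := (b : ℝ)⁻¹ ^ p / 2 with hs
  have hs0 : 0 ≤ s := by positivity
  set A := coverInd par Sel p n z with hA
  set φ := treePotential par Sel p (b : ℝ)⁻¹ n z with hφ
  have hW := treeWeight_pos par Sel p s n z
  have key : Real.exp (s * A) * (φ - (b : ℝ)⁻¹ ^ p * A) ≤ φ := by
    have h1 : φ ≤ 2 := treePotential_le_two par Sel p (by positivity) n z
    have h2 := Real.add_one_le_exp (-(s * A))
    have hφ0 : 0 ≤ φ := by
      refine le_trans ?_ (one_add_le_treePotential par Sel p (by positivity) ?_ n z)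
      · positivity
      · rw [one_div]; apply inv_anti₀ two_pos; exact_mod_cast hb
    have hA0 : 0 ≤ A := coverInd_nonneg ..
    have h3 : φ - (b : ℝ)⁻¹ ^ p * A ≤ φ * (1 - s * A) := by
      have : (b : ℝ)⁻¹ ^ p = 2 * s := by rw [hs]; ring
      rw [this]
      nlinarith [mul_nonneg hs0 hA0]
    have h4 : φ * (1 - s * A) ≤ φ * Real.exp (-(s * A)) := by gcongr; linarith
    calc Real.exp (s * A) * (φ - (b : ℝ)⁻¹ ^ p * A)
        ≤ Real.exp (s * A) * (φ * Real.exp (-(s * A))) := by gcongr; linarith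
      _ = φ := by rw [Real.exp_neg]; field_simp
  calc _ = treeWeight par Sel p s n z * Real.exp (s * A) *
        ∑ z' ∈ ch z, (1 / 2 ^ p : ℝ) ^ coverInd par Sel 0 (n + 1) z' *
        treePotential par Sel p (b : ℝ)⁻¹ (n + 1) z' := by
        rw [Finset.mul_sum]
        refine Finset.sum_congr rfl fun z' hz' => ?_
        rw [treeWeight, (hch z z').1 hz']
        ring
    _ ≤ treeWeight par Sel p s n z * Real.exp (s * A) * (b * (φ - (b : ℝ)⁻¹ ^ p * A)) := by
        gcongr
        exact sum_rpow_coverInd_mul_treePotential_le hch hcard hb Sel hp n z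
    _ = b * (treeWeight par Sel p s n z * (Real.exp (s * A) * (φ - (b : ℝ)⁻¹ ^ p * A))) := by ring
    _ ≤ _ := by gcongr

/-- The descendants of `z` which are `n` levels below. -/
def treeDesc [DecidableEq ι] (ch : ι → Finset ι) (z : ι) : ℕ → Finset ι
  | 0 => {z}
  | n + 1 => (treeDesc ch z n).biUnion ch

lemma mem_treeDesc [DecidableEq ι] {par : ι → ι} {ch : ι → Finset ι}
    (hch : ∀ z z', z' ∈ ch z ↔ par z' = z) {z w : ι} {n : ℕ} :
    w ∈ treeDesc ch z n ↔ par^[n] w = z := by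
  induction n generalizing w with
  | zero => simp [treeDesc]
  | succ n ih => simp [treeDesc, ih, hch]

lemma card_treeDesc_le [DecidableEq ι] {ch : ι → Finset ι} {b : ℕ}
    (hcard : ∀ z, (ch z).card = b) (z : ι) (n : ℕ) : (treeDesc ch z n).card ≤ b ^ n := by
  induction n with
  | zero => simp [treeDesc]
  | succ n ih =>
    calc _ ≤ (treeDesc ch z n).card * b :=
        Finset.card_biUnion_le_card_mul _ _ _ fun z _ => (hcard z).le
      _ ≤ _ := by rw [pow_succ]; gcongr

lemma sum_treeDesc_treeWeight_le [DecidableEq ι] {par : ι → ι} {ch : ι → Finset ι}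
    (hch : ∀ z z', z' ∈ ch z ↔ par z' = z) {b : ℕ} (hcard : ∀ z, (ch z).card = b) (hb : 2 ≤ b)
    (Sel : ℕ → Set ι) {p : ℕ} (hp : 1 ≤ p) (n : ℕ) (z : ι) :
    ∑ w ∈ treeDesc ch z n, (b : ℝ)⁻¹ ^ n * treeWeight par Sel p ((b : ℝ)⁻¹ ^ p / 2) n w ≤ 2 := by
  have hb0 : (0 : ℝ) < b := by positivity
  have hq' : (b : ℝ)⁻¹ ≤ 1 / 2 := by
    rw [one_div]; apply inv_anti₀ two_pos; exact_mod_cast hb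
  have key : ∑ w ∈ treeDesc ch z n, (b : ℝ)⁻¹ ^ n * (treeWeight par Sel p ((b : ℝ)⁻¹ ^ p / 2) n w *
      treePotential par Sel p (b : ℝ)⁻¹ n w) ≤ 2 := by
    induction n with
    | zero =>
      simpa [treeDesc, treeWeight] using treePotential_le_two par Sel p (by positivity) 0 z
    | succ n ih =>
      rw [treeDesc, Finset.sum_biUnion]
      · refine le_trans (Finset.sum_le_sum fun w _ => ?_) ih
        rw [← Finset.mul_sum]
        refine (mul_le_mul_of_nonneg_left
          (sum_treeWeight_mul_treePotential_le hch hcard hb Sel hp n w) (by positivity)).trans ?_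
        rw [pow_succ, mul_assoc, inv_mul_cancel_left₀ hb0.ne']
      · intro u _ v _ huv
        rw [Function.onFun, Finset.disjoint_left]
        intro w hu hv
        exact huv (((hch u w).1 hu).symm.trans ((hch v w).1 hv))
  refine le_trans (Finset.sum_le_sum fun w _ => ?_) key
  have h1 := one_add_le_treePotential par Sel p (by positivity) hq' n w
  have h2 : (0 : ℝ) < 1 / 2 ^ (p - 1) := by positivity
  have := treeWeight_pos par Sel p ((b : ℝ)⁻¹ ^ p / 2) n w
  gcongr
  exact le_mul_of_one_le_right this.le (by linarith)

end Tree

section TreeMeasure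

variable {ι X : Type*}

/-- The product of the factors `T`, one for each level at which the ancestor lies in `E`. -/
noncomputable def hitProd (par : ι → ι) (E : ℕ → Set ι) (T : ℝ≥0∞) : ℕ → ι → ℝ≥0∞
  | 0, _ => 1
  | l + 1, z => hitProd par E T l (par z) * (E (l + 1)).indicator (fun _ => T) z +
      hitProd par E T l (par z) * (E (l + 1))ᶜ.indicator 1 z

lemma hitProd_apply {par : ι → ι} {e : ℕ → X → ι}
    (hpar : ∀ l x, par (e (l + 1) x) = e l x) (E : ℕ → Set ι) (T : ℝ≥0∞) (l : ℕ) (x : X) :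
    hitProd par E T l (e l x) =
      T ^ ∑ i ∈ Finset.range l, (E (i + 1)).indicator (1 : ι → ℕ) (e (i + 1) x) := by
  induction l with
  | zero => simp [hitProd]
  | succ l ih =>
    rw [hitProd, hpar, ih, Finset.sum_range_succ, pow_add]
    by_cases hx : e (l + 1) x ∈ E (l + 1) <;> simp [hx]

lemma treeWeight_apply {par : ι → ι} {c : ℕ → X → ι} (hpar : ∀ n x, par (c (n + 1) x) = c n x)
    (Sel : ℕ → Set ι) (p : ℕ) (s : ℝ) (n : ℕ) (x : X) :
    treeWeight par Sel p s n (c n x) =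
      Real.exp (s * ∑ k ∈ Finset.range n, coverInd par Sel p k (c k x)) *
      (1 / 2 ^ p) ^ ∑ m ∈ Finset.range n, (Sel (m + 1)).indicator (1 : ι → ℕ) (c (m + 1) x) := by
  induction n with
  | zero => simp [treeWeight]
  | succ n ih =>
    have h : (1 / 2 ^ p : ℝ) ^ coverInd par Sel 0 (n + 1) (c (n + 1) x) =
        (1 / 2 ^ p : ℝ) ^ (Sel (n + 1)).indicator (1 : ι → ℕ) (c (n + 1) x) := by
      by_cases hx : c (n + 1) x ∈ Sel (n + 1) <;> simp [coverInd, hx]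
    rw [treeWeight, hpar, ih, h, Finset.sum_range_succ, Finset.sum_range_succ, pow_add, mul_add,
      Real.exp_add]
    ring

lemma sum_range_succ_le_of_le_one {f : ℕ → ℕ} (hf : ∀ m, f m ≤ 1) {p : ℕ} (hp : 1 ≤ p) (n : ℕ) :
    ∑ m ∈ Finset.range n, f (m + 1) ≤
      p + ∑ a ∈ Finset.range p, ∑ i ∈ Finset.range n, f (a + (i + 1) * p) := by
  have h1 : ∀ k, ∑ m ∈ Finset.range (k * p), f m =
      ∑ i ∈ Finset.range k, ∑ a ∈ Finset.range p, f (a + i * p) := by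
    intro k
    induction k with
    | zero => simp
    | succ k ih =>
      rw [Nat.succ_mul, Finset.sum_range_add, ih, Finset.sum_range_succ]
      simp only [add_comm (k * p)]
  have h2 : n + 1 ≤ (n + 1) * p := Nat.le_mul_of_pos_right _ hp
  calc ∑ m ∈ Finset.range n, f (m + 1) ≤ ∑ m ∈ Finset.range (n + 1), f m := by
        rw [Finset.sum_range_succ']; exact Nat.le_add_right _ _
    _ ≤ ∑ m ∈ Finset.range ((n + 1) * p), f m :=
        Finset.sum_le_sum_of_subset (Finset.range_mono h2)
    _ = ∑ i ∈ Finset.range n, ∑ a ∈ Finset.range p, f (a + (i + 1) * p) +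
          ∑ a ∈ Finset.range p, f (a + 0 * p) := by rw [h1, Finset.sum_range_succ']
    _ ≤ ∑ i ∈ Finset.range n, ∑ a ∈ Finset.range p, f (a + (i + 1) * p) +
          ∑ a ∈ Finset.range p, 1 := by gcongr; exact hf _
    _ = _ := by rw [Finset.sum_comm]; simp [add_comm]

variable [MeasurableSpace X] (μ : Measure X)

lemma lintegral_hitProd_le [Countable ι] [MeasurableSpace ι] [MeasurableSingletonClass ι]
    [IsProbabilityMeasure μ] {par : ι → ι} {e : ℕ → X → ι} (he : ∀ l, Measurable (e l))
    (hpar : ∀ l x, par (e (l + 1) x) = e l x) (E : ℕ → Set ι) (T κ : ℝ≥0∞)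
    (hE : ∀ l u, μ {x | e l x = u ∧ e (l + 1) x ∈ E (l + 1)} ≤ κ * μ {x | e l x = u}) (l : ℕ) :
    ∫⁻ x, hitProd par E T l (e l x) ∂μ ≤ (1 + T * κ) ^ l := by
  have hmeas : ∀ F : ι → ℝ≥0∞, Measurable F := fun F => measurable_of_countable F
  induction l with
  | zero => simp [hitProd]
  | succ l ih =>
    set S : Set X := {x | e (l + 1) x ∈ E (l + 1)} with hS
    have hSm : MeasurableSet S := he (l + 1) (Set.to_countable _).measurableSet
    set F := hitProd par E T l with hF
    have h1 : ∫⁻ x in S, F (e l x) ∂μ ≤ κ * ∫⁻ x, F (e l x) ∂μ := by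
      rw [← lintegral_map (hmeas F) (he l), ← lintegral_map (hmeas F) (he l),
        lintegral_countable', lintegral_countable', ← ENNReal.tsum_mul_left]
      refine ENNReal.tsum_le_tsum fun u => ?_
      rw [Measure.map_apply (he l) (measurableSet_singleton u),
        Measure.map_apply (he l) (measurableSet_singleton u),
        Measure.restrict_apply (he l (measurableSet_singleton u)), mul_left_comm]
      gcongr
      exact hE l u
    calc ∫⁻ x, hitProd par E T (l + 1) (e (l + 1) x) ∂μ
        ≤ ∫⁻ x, F (e l x) + T * S.indicator (fun x => F (e l x)) x ∂μ := by
          refine lintegral_mono fun x => ?_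
          simp only [hitProd, hpar]
          by_cases hx : e (l + 1) x ∈ E (l + 1)
          · have : x ∈ S := hx
            simp [hx, this, mul_comm T, ← hF]
          · have : x ∉ S := hx
            simp [hx, this, ← hF]
      _ = ∫⁻ x, F (e l x) ∂μ + T * ∫⁻ x in S, F (e l x) ∂μ := by
          have hFm : Measurable fun x => F (e l x) := (hmeas F).comp (he l)
          rw [lintegral_add_left hFm, lintegral_const_mul _ (hFm.indicator hSm),
            lintegral_indicator hSm]
      _ ≤ ∫⁻ x, F (e l x) ∂μ + T * (κ * ∫⁻ x, F (e l x) ∂μ) := by gcongr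
      _ = (1 + T * κ) * ∫⁻ x, F (e l x) ∂μ := by ring
      _ ≤ (1 + T * κ) * (1 + T * κ) ^ l := by gcongr
      _ = _ := by ring

/-- If the events `e (l + 1) x ∈ E (l + 1)` have small conditional probability given `e l x`,
then almost surely they occur with small frequency. -/
lemma ae_eventually_mul_sum_indicator_le [Countable ι] [MeasurableSpace ι]
    [MeasurableSingletonClass ι]
    [IsProbabilityMeasure μ] {par : ι → ι} {e : ℕ → X → ι} (he : ∀ l, Measurable (e l))
    (hpar : ∀ l x, par (e (l + 1) x) = e l x) (E : ℕ → Set ι) (D : ℕ)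
    (hE : ∀ l u, μ {x | e l x = u ∧ e (l + 1) x ∈ E (l + 1)} ≤
      ((4 : ℝ≥0∞) ^ D)⁻¹ * μ {x | e l x = u}) :
    ∀ᵐ x ∂μ, ∀ᶠ l : ℕ in atTop,
      D * ∑ i ∈ Finset.range l, (E (i + 1)).indicator (1 : ι → ℕ) (e (i + 1) x) ≤ l := by
  set T : ℝ≥0∞ := 4 ^ D with hT
  have hT0 : T ≠ 0 := by positivity
  have hT1 : T ≠ ∞ := ENNReal.pow_ne_top (by norm_num)
  have hbad : ∀ l : ℕ, μ {x | ¬ D * ∑ i ∈ Finset.range l,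
      (E (i + 1)).indicator (1 : ι → ℕ) (e (i + 1) x) ≤ l} ≤ (2⁻¹ : ℝ≥0∞) ^ l := by
    intro l
    have h1 := lintegral_hitProd_le μ he hpar E T T⁻¹ hE l
    rw [ENNReal.mul_inv_cancel hT0 hT1, one_add_one_eq_two] at h1
    have h2 : (4 : ℝ≥0∞) ^ l * μ {x | (4 : ℝ≥0∞) ^ l ≤ hitProd par E T l (e l x)} ≤ 2 ^ l :=
      (mul_meas_ge_le_lintegral ((measurable_of_countable (hitProd par E T l)).comp (he l))
        _).trans h1
    have h3 : {x | ¬ D * ∑ i ∈ Finset.range l,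
        (E (i + 1)).indicator (1 : ι → ℕ) (e (i + 1) x) ≤ l} ⊆
        {x | (4 : ℝ≥0∞) ^ l ≤ hitProd par E T l (e l x)} := by
      intro x hx
      rw [mem_ofPred_eq, not_le] at hx
      rw [mem_ofPred_eq]
      rw [hitProd_apply hpar, hT, ← pow_mul]
      exact pow_le_pow_right₀ (by norm_num) hx.le
    have h4 : (4 : ℝ≥0∞) ^ l = 2 ^ l * 2 ^ l := by rw [← mul_pow]; norm_num
    have h5 : (2 : ℝ≥0∞) ^ l * μ {x | (4 : ℝ≥0∞) ^ l ≤ hitProd par E T l (e l x)} ≤ 1 := by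
      refine (ENNReal.mul_le_mul_iff_right (a := 2 ^ l) (by positivity)
        (ENNReal.pow_ne_top (by norm_num))).1 ?_
      rw [← mul_assoc, ← h4, mul_one]
      exact h2
    refine (measure_mono h3).trans ?_
    rw [← ENNReal.inv_pow]
    rw [mul_comm] at h5
    exact ENNReal.le_inv_iff_mul_le.2 h5
  refine ae_eventually_notMem (s := fun l : ℕ => {x | ¬ D * ∑ i ∈ Finset.range l,
      (E (i + 1)).indicator (1 : ι → ℕ) (e (i + 1) x) ≤ l}) ?_ |>.mono fun x hx => ?_
  · refine ne_top_of_le_ne_top ?_ (ENNReal.tsum_le_tsum hbad)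
    rw [ENNReal.tsum_geometric]
    simp
  · filter_upwards [hx] with l hl
    simpa using hl

/-- A measure is almost surely not much smaller than any weight with bounded total mass. -/
lemma ae_eventually_exp_mul_treeWeight_le [DecidableEq ι] [Countable ι] [IsProbabilityMeasure μ]
    {par : ι → ι} {ch : ι → Finset ι}
    (hch : ∀ z z', z' ∈ ch z ↔ par z' = z) {b : ℕ} (hcard : ∀ z, (ch z).card = b) (hb : 2 ≤ b)
    {c : ℕ → X → ι} (hpar : ∀ n x, par (c (n + 1) x) = c n x)
    (Sel : ℕ → Set ι) {p : ℕ} (hp : 1 ≤ p) {δ : ℝ} (hδ : 0 < δ) :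
    ∀ᵐ x ∂μ, ∀ᶠ n : ℕ in atTop,
      Real.exp (-δ * n) * ((b : ℝ)⁻¹ ^ n * treeWeight par Sel p ((b : ℝ)⁻¹ ^ p / 2) n (c n x)) ≤
        (μ {y | c n y = c n x}).toReal := by
  set g : ℕ → ι → ℝ := fun n z => Real.exp (-δ * n) *
    ((b : ℝ)⁻¹ ^ n * treeWeight par Sel p ((b : ℝ)⁻¹ ^ p / 2) n z) with hg
  have hg0 : ∀ n z, 0 ≤ g n z := fun n z => by
    have := treeWeight_pos par Sel p ((b : ℝ)⁻¹ ^ p / 2) n z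
    positivity
  have hiter : ∀ n x, par^[n] (c n x) = c 0 x := by
    intro n x
    induction n with
    | zero => rfl
    | succ n ih => rw [Function.iterate_succ_apply, hpar, ih]
  have hbad : ∀ z₀ : ι, ∀ n : ℕ,
      μ {x | c 0 x = z₀ ∧ (μ {y | c n y = c n x}).toReal < g n (c n x)} ≤
        ENNReal.ofReal (2 * Real.exp (-δ) ^ n) := by
    intro z₀ n
    have hsub : {x | c 0 x = z₀ ∧ (μ {y | c n y = c n x}).toReal < g n (c n x)} ⊆
        ⋃ z ∈ (treeDesc ch z₀ n).filter fun z => (μ {y | c n y = z}).toReal < g n z,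
          {y | c n y = z} := by
      rintro x ⟨hx, hx'⟩
      simp only [mem_iUnion, Finset.mem_filter, mem_treeDesc hch]
      exact ⟨c n x, ⟨(hiter n x).trans hx, hx'⟩, rfl⟩
    calc _ ≤ _ := measure_mono hsub
      _ ≤ ∑ z ∈ (treeDesc ch z₀ n).filter fun z => (μ {y | c n y = z}).toReal < g n z,
          μ {y | c n y = z} := measure_biUnion_finset_le _ _
      _ ≤ ∑ z ∈ (treeDesc ch z₀ n).filter fun z => (μ {y | c n y = z}).toReal < g n z,
          ENNReal.ofReal (g n z) := by
        refine Finset.sum_le_sum fun z hz => ?_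
        rw [← ENNReal.ofReal_toReal (measure_ne_top μ {y | c n y = z})]
        exact ENNReal.ofReal_le_ofReal (Finset.mem_filter.1 hz).2.le
      _ ≤ ∑ z ∈ treeDesc ch z₀ n, ENNReal.ofReal (g n z) :=
        Finset.sum_le_sum_of_subset (Finset.filter_subset _ _)
      _ = ENNReal.ofReal (∑ z ∈ treeDesc ch z₀ n, g n z) :=
        (ENNReal.ofReal_sum_of_nonneg fun z _ => hg0 n z).symm
      _ ≤ _ := by
        apply ENNReal.ofReal_le_ofReal
        rw [hg, ← Finset.mul_sum, ← Real.exp_nat_mul, mul_comm (n : ℝ), mul_comm 2]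
        gcongr
        exact sum_treeDesc_treeWeight_le hch hcard hb Sel hp n z₀
  have hsum : ∀ z₀ : ι, ∀ᵐ x ∂μ, ∀ᶠ n : ℕ in atTop,
      x ∉ {x | c 0 x = z₀ ∧ (μ {y | c n y = c n x}).toReal < g n (c n x)} := by
    intro z₀
    refine ae_eventually_notMem (ne_top_of_le_ne_top ?_ (ENNReal.tsum_le_tsum (hbad z₀)))
    have : Summable fun n : ℕ => 2 * Real.exp (-δ) ^ n :=
      (summable_geometric_of_lt_one (Real.exp_pos _).le (by simpa using hδ)).mul_left 2
    exact this.tsum_ofReal_ne_top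
  filter_upwards [ae_all_iff.2 hsum] with x hx
  filter_upwards [hx (c 0 x)] with n hn
  exact not_lt.1 fun h => hn ⟨rfl, h⟩

/-- Lower bound for the measure of the nodes of a tree, in terms of the number of ancestors which
have an almost null descendant `p` levels below. -/
theorem exists_pos_ae_eventually_le_measure [DecidableEq ι] [Countable ι] [MeasurableSpace ι]
    [MeasurableSingletonClass ι] [IsProbabilityMeasure μ] {par : ι → ι} {ch : ι → Finset ι}
    (hch : ∀ z z', z' ∈ ch z ↔ par z' = z) {b : ℕ} (hcard : ∀ z, (ch z).card = b) (hb : 2 ≤ b)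
    {c : ℕ → X → ι} (hc : ∀ n, Measurable (c n)) (hpar : ∀ n x, par (c (n + 1) x) = c n x)
    {p : ℕ} (hp : 1 ≤ p) {δ : ℝ} (hδ : 0 < δ) :
    ∃ ε > 0, ∀ᵐ x ∂μ, ∀ᶠ n : ℕ in atTop,
      Real.exp (-δ * n) * ((b : ℝ)⁻¹ ^ n * Real.exp ((b : ℝ)⁻¹ ^ p / 2 *
        Set.ncard {k : ℕ | k < n ∧ ∃ w, par^[p] w = c k x ∧
          μ {y | c (k + p) y = w} ≤ ENNReal.ofReal ε * μ {y | c k y = c k x}})) ≤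
        (μ {y | c n y = c n x}).toReal := by
  have hb0 : (0 : ℝ) < b := by positivity
  set Q : ℝ := p * Real.log 2 * p with hQ
  have hQ0 : 0 < Q := by have := Real.log_pos one_lt_two; positivity
  obtain ⟨D, hD⟩ := exists_nat_gt (4 * Q / δ)
  have hD0 : (0 : ℝ) < D := lt_trans (by positivity) hD
  set ε : ℝ := ((4 : ℝ) ^ D)⁻¹ * ((b : ℝ) ^ p)⁻¹ with hε
  have hε0 : 0 < ε := by positivity
  have hεE : (b : ℝ≥0∞) ^ p * ENNReal.ofReal ε = ((4 : ℝ≥0∞) ^ D)⁻¹ := by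
    have h1 : (b : ℝ≥0∞) ^ p = ENNReal.ofReal ((b : ℝ) ^ p) := by
      rw [ENNReal.ofReal_pow hb0.le, ENNReal.ofReal_natCast]
    have h2 : (4 : ℝ≥0∞) = ENNReal.ofReal 4 := by norm_num
    rw [h1, h2, ← ENNReal.ofReal_pow (by norm_num), ← ENNReal.ofReal_inv_of_pos (by positivity),
      ← ENNReal.ofReal_mul (by positivity), hε]
    congr 1
    field_simp
  set Sel : ℕ → Set ι := fun m => {w | μ {y | c m y = w} ≤
    ENNReal.ofReal ε * μ {y | par^[p] (c m y) = par^[p] w}} with hSel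
  have hiter : ∀ j n x, par^[j] (c (n + j) x) = c n x := by
    intro j n x
    induction j with
    | zero => rfl
    | succ j ih => rw [Function.iterate_succ_apply, ← add_assoc, hpar, ih]
  have hhit : ∀ a : ℕ, ∀ᵐ x ∂μ, ∀ᶠ l : ℕ in atTop, D * ∑ i ∈ Finset.range l,
      (Sel (a + (i + 1) * p)).indicator (1 : ι → ℕ) (c (a + (i + 1) * p) x) ≤ l := by
    intro a
    refine ae_eventually_mul_sum_indicator_le μ (par := par^[p]) (e := fun l => c (a + l * p))
      (fun l => hc _) (fun l x => ?_) (fun l => Sel (a + l * p)) D (fun l u => ?_)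
    · rw [show a + (l + 1) * p = (a + l * p) + p by ring, hiter]
    · rw [show a + (l + 1) * p = (a + l * p) + p by ring]
      set k := a + l * p
      have hsub : {x | c k x = u ∧ c (k + p) x ∈ Sel (k + p)} ⊆
          ⋃ w ∈ (treeDesc ch u p).filter fun w => μ {y | c (k + p) y = w} ≤
            ENNReal.ofReal ε * μ {y | c k y = u}, {y | c (k + p) y = w} := by
        rintro x ⟨hx, hx'⟩
        simp only [mem_iUnion, Finset.mem_filter, mem_treeDesc hch]
        refine ⟨c (k + p) x, ⟨(hiter p k x).trans hx, ?_⟩, rfl⟩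
        have h3 : μ {y | c (k + p) y = c (k + p) x} ≤
          ENNReal.ofReal ε * μ {y | par^[p] (c (k + p) y) = par^[p] (c (k + p) x)} := hx'
        simpa only [hiter, hx] using h3
      calc _ ≤ _ := measure_mono hsub
        _ ≤ _ := measure_biUnion_finset_le _ _
        _ ≤ ∑ w ∈ (treeDesc ch u p).filter fun w => μ {y | c (k + p) y = w} ≤
            ENNReal.ofReal ε * μ {y | c k y = u}, ENNReal.ofReal ε * μ {y | c k y = u} :=
          Finset.sum_le_sum fun w hw => (Finset.mem_filter.1 hw).2
        _ ≤ ∑ w ∈ treeDesc ch u p, ENNReal.ofReal ε * μ {y | c k y = u} :=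
          Finset.sum_le_sum_of_subset (Finset.filter_subset _ _)
        _ = ((treeDesc ch u p).card : ℝ≥0∞) * (ENNReal.ofReal ε * μ {y | c k y = u}) := by
          rw [Finset.sum_const, nsmul_eq_mul]
        _ ≤ (b : ℝ≥0∞) ^ p * (ENNReal.ofReal ε * μ {y | c k y = u}) := by
          gcongr
          exact_mod_cast card_treeDesc_le hcard u p
        _ = _ := by rw [← mul_assoc, hεE]
  refine ⟨ε, hε0, ?_⟩
  filter_upwards [ae_eventually_exp_mul_treeWeight_le μ hch hcard hb hpar Sel hp (half_pos hδ),
    ae_all_iff.2 hhit] with x hx hxh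
  have hxh' : ∀ᶠ l : ℕ in atTop, ∀ a ∈ Finset.range p, D * ∑ i ∈ Finset.range l,
      (Sel (a + (i + 1) * p)).indicator (1 : ι → ℕ) (c (a + (i + 1) * p) x) ≤ l :=
    (Filter.eventually_all_finset _).2 fun a _ => hxh a
  filter_upwards [hx, hxh', eventually_ge_atTop D] with n hn hnh hnD
  refine le_trans ?_ hn
  rw [treeWeight_apply hpar]
  set s := (b : ℝ)⁻¹ ^ p / 2
  set H := ∑ m ∈ Finset.range n, (Sel (m + 1)).indicator (1 : ι → ℕ) (c (m + 1) x) with hH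
  have hHle : (D : ℝ) * H ≤ D * p + p * n := by
    have h1 : H ≤ _ := sum_range_succ_le_of_le_one
      (f := fun m => (Sel m).indicator (1 : ι → ℕ) (c m x))
      (fun m => Set.indicator_le_self' (fun _ _ => zero_le_one) _) hp n
    have h2 : D * H ≤ D * p + p * n := by
      calc D * H ≤ _ := Nat.mul_le_mul_left D h1
        _ = D * p + ∑ a ∈ Finset.range p, D * ∑ i ∈ Finset.range n,
            (Sel (a + (i + 1) * p)).indicator (1 : ι → ℕ) (c (a + (i + 1) * p) x) := by
          rw [mul_add, Finset.mul_sum]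
        _ ≤ D * p + ∑ a ∈ Finset.range p, n := by
          gcongr with a ha
          exact hnh a ha
        _ = _ := by simp
    exact_mod_cast h2
  have hcount : (Set.ncard {k : ℕ | k < n ∧ ∃ w, par^[p] w = c k x ∧
      μ {y | c (k + p) y = w} ≤ ENNReal.ofReal ε * μ {y | c k y = c k x}} : ℝ) ≤
      ∑ k ∈ Finset.range n, coverInd par Sel p k (c k x) := by
    classical
    set P : ℕ → Prop := fun k => ∃ w, par^[p] w = c k x ∧
      μ {y | c (k + p) y = w} ≤ ENNReal.ofReal ε * μ {y | c k y = c k x} with hP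
    have h1 : {k : ℕ | k < n ∧ P k} = ((Finset.range n).filter P : Finset ℕ) := by
      ext k; simp
    rw [h1, Set.ncard_coe_finset, Finset.card_filter, Nat.cast_sum]
    refine Finset.sum_le_sum fun k _ => ?_
    by_cases hk : P k
    · obtain ⟨w, hw, hw'⟩ := hk
      have h2 : c k x ∈ par^[p] '' Sel (k + p) := by
        refine ⟨w, ?_, hw⟩
        rw [hSel]
        simpa only [mem_ofPred_eq, hiter, hw] using hw'
      have h3 : coverInd par Sel p k (c k x) = 1 := by
        simp only [coverInd]; rw [Set.indicator_of_mem h2]; rfl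
      rw [h3]
      split_ifs <;> simp
    · rw [if_neg hk, Nat.cast_zero]
      exact coverInd_nonneg ..
  have hpen : Real.exp (-(δ / 2) * n) ≤ (1 / 2 ^ p : ℝ) ^ H := by
    have h1 : (1 / 2 ^ p : ℝ) ^ H = Real.exp (-(p * Real.log 2 * H)) := by
      rw [Real.exp_neg, one_div, inv_pow, ← pow_mul,
        show (p : ℝ) * Real.log 2 * H = ((p * H : ℕ) : ℝ) * Real.log 2 by push_cast; ring,
        Real.exp_nat_mul, Real.exp_log two_pos]
    rw [h1, Real.exp_le_exp]
    have hnD' : (D : ℝ) ≤ n := by exact_mod_cast hnD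
    have hlog := Real.log_pos one_lt_two
    have h2 : (D : ℝ) * H ≤ 2 * p * n := by nlinarith [(Nat.cast_nonneg p : (0 : ℝ) ≤ p)]
    have h3 : D * (p * Real.log 2 * H) ≤ 2 * Q * n := by
      calc D * (p * Real.log 2 * H) = p * Real.log 2 * (D * H) := by ring
        _ ≤ p * Real.log 2 * (2 * p * n) := by gcongr
        _ = _ := by rw [hQ]; ring
    have h4 : 4 * Q ≤ D * δ := ((div_lt_iff₀ hδ).1 hD).le
    have h5 : D * (p * Real.log 2 * H) ≤ D * (δ / 2 * n) := by
      nlinarith [(Nat.cast_nonneg n : (0 : ℝ) ≤ n)]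
    have h6 := le_of_mul_le_mul_left h5 hD0
    linarith
  have hs : 0 ≤ s := by positivity
  calc _ = Real.exp (-(δ / 2) * n) * ((b : ℝ)⁻¹ ^ n * (Real.exp (s * (Set.ncard {k : ℕ | k < n ∧
        ∃ w, par^[p] w = c k x ∧ μ {y | c (k + p) y = w} ≤
          ENNReal.ofReal ε * μ {y | c k y = c k x}} : ℝ)) * Real.exp (-(δ / 2) * n))) := by
        have : Real.exp (-δ * n) = Real.exp (-(δ / 2) * n) * Real.exp (-(δ / 2) * n) := by
          rw [← Real.exp_add]; ring_nf
        rw [this]; ring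
    _ ≤ _ := by gcongr

end TreeMeasure

section Grid

variable {d : ℕ}

/-- The index of the cube of side `S / 2 ^ k` containing `x`, in the grid translated by `-S • t`. -/
noncomputable def gridIdx (S : ℝ) (t : Fin d → ℝ) (k : ℕ) (x : EuclideanSpace ℝ (Fin d)) :
    Fin d → ℤ :=
  fun j => ⌊2 ^ k * (x j / S + t j)⌋

/-- The index of the dyadic parent. -/
def gridParent (z : Fin d → ℤ) : Fin d → ℤ := fun j => z j / 2

/-- The indices of the dyadic children. -/
def gridChildren (z : Fin d → ℤ) : Finset (Fin d → ℤ) :=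
  Fintype.piFinset fun j => {2 * z j, 2 * z j + 1}

lemma mem_gridChildren (z z' : Fin d → ℤ) : z' ∈ gridChildren z ↔ gridParent z' = z := by
  simp only [gridChildren, Fintype.mem_piFinset, Finset.mem_insert, Finset.mem_singleton,
    gridParent, funext_iff]
  refine forall_congr' fun j => ?_
  omega

lemma card_gridChildren (z : Fin d → ℤ) : (gridChildren z).card = 2 ^ d := by
  rw [gridChildren, Fintype.card_piFinset]
  have : ∀ j, ({2 * z j, 2 * z j + 1} : Finset ℤ).card = 2 := fun j =>
    Finset.card_pair (by omega)
  simp [this]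

lemma measurable_gridIdx (S : ℝ) (t : Fin d → ℝ) (k : ℕ) : Measurable (gridIdx S t k) := by
  unfold gridIdx
  refine measurable_pi_lambda _ fun j => Int.measurable_floor.comp ?_
  fun_prop

lemma gridParent_gridIdx (S : ℝ) (t : Fin d → ℝ) (k : ℕ) (x : EuclideanSpace ℝ (Fin d)) :
    gridParent (gridIdx S t (k + 1) x) = gridIdx S t k x := by
  funext j
  simp only [gridParent, gridIdx]
  set u : ℝ := 2 ^ k * (x j / S + t j) with hu
  have h : (2 : ℝ) ^ (k + 1) * (x j / S + t j) = 2 * u := by rw [hu, pow_succ]; ring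
  rw [h]
  have h1 : 2 * ⌊u⌋ ≤ ⌊2 * u⌋ := Int.le_floor.2 (by push_cast; linarith [Int.floor_le u])
  have h2 : ⌊2 * u⌋ < 2 * ⌊u⌋ + 2 :=
    Int.floor_lt.2 (by push_cast; linarith [Int.lt_floor_add_one u])
  omega

lemma gridParent_iterate_gridIdx (S : ℝ) (t : Fin d → ℝ) (k p : ℕ)
    (x : EuclideanSpace ℝ (Fin d)) :
    gridParent^[p] (gridIdx S t (k + p) x) = gridIdx S t k x := by
  induction p with
  | zero => rfl
  | succ p ih => rw [Function.iterate_succ_apply, ← add_assoc, gridParent_gridIdx, ih]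

lemma dist_le_of_gridIdx_eq {S : ℝ} (hS : 0 < S) {t : Fin d → ℝ} {k : ℕ}
    {x y : EuclideanSpace ℝ (Fin d)} (h : gridIdx S t k y = gridIdx S t k x) :
    dist y x ≤ √d * (S / 2 ^ k) := by
  have hc : ∀ j, dist (y j) (x j) ^ 2 ≤ (S / 2 ^ k) ^ 2 := by
    intro j
    have h1 := Int.abs_sub_lt_one_of_floor_eq_floor (congrFun h j)
    have h2 : 2 ^ k * (y j / S + t j) - 2 ^ k * (x j / S + t j) = (y j - x j) / (S / 2 ^ k) := by
      field_simp; ring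
    have hS' : 0 < S / 2 ^ k := by positivity
    rw [h2, abs_div, abs_of_pos hS', div_lt_one hS'] at h1
    rw [Real.dist_eq]
    exact pow_le_pow_left₀ (abs_nonneg _) h1.le 2
  rw [EuclideanSpace.dist_eq]
  apply Real.sqrt_le_iff.2 ⟨by positivity, ?_⟩
  calc _ ≤ ∑ _j : Fin d, (S / 2 ^ k) ^ 2 := Finset.sum_le_sum fun j _ => hc j
    _ = _ := by
      rw [mul_pow, Real.sq_sqrt (Nat.cast_nonneg d)]
      simp

lemma gridIdx_eq_of_dist_le {S τ R : ℝ} (hS : 0 < S) {t : Fin d → ℝ} {k : ℕ}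
    {x y : EuclideanSpace ℝ (Fin d)}
    (hx : ∀ j, τ ≤ Int.fract (2 ^ k * (x j / S + t j)) ∧
      Int.fract (2 ^ k * (x j / S + t j)) < 1 - τ)
    (hR : 2 ^ k * R ≤ τ * S) (hy : dist y x ≤ R) : gridIdx S t k y = gridIdx S t k x := by
  funext j
  simp only [gridIdx]
  obtain ⟨h1, h2⟩ := hx j
  set u : ℝ := 2 ^ k * (x j / S + t j)
  have h3 : |y j - x j| ≤ R := by
    have := EuclideanSpace.norm_eq (y - x)
    rw [← Real.norm_eq_abs, ← PiLp.sub_apply]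
    exact (PiLp.norm_apply_le (y - x) j).trans (by rwa [← dist_eq_norm])
  have h4 : 2 ^ k * (y j / S + t j) = u + 2 ^ k * (y j - x j) / S := by
    simp only [u]; field_simp; ring
  have h5 : |2 ^ k * (y j - x j) / S| ≤ τ := by
    rw [abs_div, abs_mul, abs_of_pos hS, abs_of_pos (by positivity : (0 : ℝ) < 2 ^ k),
      div_le_iff₀ hS]
    refine le_trans ?_ hR
    gcongr
  rw [h4, Int.floor_eq_iff]
  have h6 := abs_le.1 h5
  have h7 := Int.floor_add_fract u
  constructor <;> linarith [h6.1, h6.2]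

/-- In a grid translated so that `x` is far from the boundary of its cube, porosity at `x` yields
an almost null descendant of the cube of `x`. -/
lemma exists_gridIdx_measure_le (μ : Measure (EuclideanSpace ℝ (Fin d)))
    {S τ R α α' ε : ℝ} (hS : 0 < S) {t : Fin d → ℝ} {k p : ℕ} {x : EuclideanSpace ℝ (Fin d)}
    (hx : ∀ j, τ ≤ Int.fract (2 ^ k * (x j / S + t j)) ∧
      Int.fract (2 ^ k * (x j / S + t j)) < 1 - τ)
    (hR0 : 0 < R) (hR : 2 ^ k * R ≤ τ * S) (hα' : 0 < α') (hαα' : α' < α)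
    (hpor : α ≤ por μ x R ε) (hp : √d * (S / 2 ^ (k + p)) ≤ α' * R) :
    ∃ w, gridParent^[p] w = gridIdx S t k x ∧
      μ {y | gridIdx S t (k + p) y = w} ≤
        ENNReal.ofReal ε * μ {y | gridIdx S t k y = gridIdx S t k x} := by
  have hlt : α' < por μ x R ε := hαα'.trans_le hpor
  rw [por] at hlt
  obtain ⟨β, ⟨hβ0, y, hyx, hyμ⟩, hβ⟩ := exists_lt_of_lt_csSup (by
    by_contra hne
    rw [Set.not_nonempty_iff_eq_empty] at hne
    rw [hne, Real.sSup_empty] at hlt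
    linarith) hlt
  have hyx' : dist y x ≤ R := hyx (mem_closedBall_self (by positivity))
  have hball : closedBall x R ⊆ {y | gridIdx S t k y = gridIdx S t k x} := fun z hz =>
    gridIdx_eq_of_dist_le hS hx hR hz
  refine ⟨gridIdx S t (k + p) y, ?_, ?_⟩
  · rw [gridParent_iterate_gridIdx, gridIdx_eq_of_dist_le hS hx hR hyx']
  · have hsub : {z | gridIdx S t (k + p) z = gridIdx S t (k + p) y} ⊆ closedBall y (β * R) := by
      intro z hz
      refine (dist_le_of_gridIdx_eq hS hz).trans (hp.trans ?_)
      gcongr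
    calc _ ≤ _ := measure_mono hsub
      _ ≤ _ := hyμ
      _ ≤ _ := by gcongr

lemma le_card_filter_fract {L g : ℕ} [NeZero L] (hL : Nat.Coprime 2 L) {τ : ℝ} (hτ : 0 < τ)
    (hg : (g : ℝ) ≤ L * (1 - 2 * τ)) (k : ℕ) (u : ℝ) :
    g ≤ (Finset.univ.filter fun a : ZMod L => τ ≤ Int.fract (2 ^ k * (u + (a.val : ℝ) / L)) ∧
      Int.fract (2 ^ k * (u + (a.val : ℝ) / L)) < 1 - τ).card := by
  have hL0 : (0 : ℝ) < L := by exact_mod_cast Nat.pos_of_ne_zero (NeZero.ne L)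
  set v : ℝ := 2 ^ k * u with hv
  set m₀ : ℤ := ⌈L * τ - L * v⌉ with hm₀
  set U : (ZMod L)ˣ := ZMod.unitOfCoprime 2 hL with hU
  have hU' : (U : ZMod L) = 2 := by simp [hU]
  set f : ℕ → ZMod L := fun i => ((m₀ + i : ℤ) : ZMod L) * (((U ^ k)⁻¹ : (ZMod L)ˣ) : ZMod L)
    with hf
  have hgL : g ≤ L := by
    have : (g : ℝ) ≤ L := hg.trans (by nlinarith)
    exact_mod_cast this
  have hinj : Set.InjOn f (Finset.range g) := by
    intro i hi j hj hij
    have hi' : i < L := (Finset.mem_range.1 hi).trans_le hgL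
    have hj' : j < L := (Finset.mem_range.1 hj).trans_le hgL
    have h1 := (Units.mul_left_inj _).1 hij
    push_cast at h1
    have h2 : (i : ZMod L) = j := add_left_cancel h1
    rw [ZMod.natCast_eq_natCast_iff'] at h2
    rwa [Nat.mod_eq_of_lt hi', Nat.mod_eq_of_lt hj'] at h2
  have hmaps : ∀ i ∈ Finset.range g, f i ∈ Finset.univ.filter fun a : ZMod L =>
      τ ≤ Int.fract (2 ^ k * (u + (a.val : ℝ) / L)) ∧
      Int.fract (2 ^ k * (u + (a.val : ℝ) / L)) < 1 - τ := by
    intro i hi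
    have hi' : (i : ℝ) + 1 ≤ g := by exact_mod_cast Finset.mem_range.1 hi
    have h1 : ((2 ^ k * (f i).val : ℤ) : ZMod L) = ((m₀ + i : ℤ) : ZMod L) := by
      have h2 : (2 : ZMod L) ^ k * ((U ^ k)⁻¹ : (ZMod L)ˣ) = 1 := by
        rw [← hU', ← Units.val_pow_eq_pow_val, Units.mul_inv]
      rw [Int.cast_mul, Int.cast_pow, Int.cast_ofNat, Int.cast_natCast, ZMod.natCast_zmod_val, hf,
        mul_left_comm, h2, mul_one]
    rw [ZMod.intCast_eq_intCast_iff_dvd_sub] at h1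
    obtain ⟨e, he⟩ := h1
    have he' : (m₀ : ℝ) + i - 2 ^ k * (f i).val = L * e := by exact_mod_cast he
    have h3 : (2 : ℝ) ^ k * (u + ((f i).val : ℝ) / L) = (v + (m₀ + i) / L) - e := by
      rw [hv]; field_simp; linarith
    have h4 : (L : ℝ) * τ - L * v ≤ m₀ := Int.le_ceil _
    have h5 : (m₀ : ℝ) < L * τ - L * v + 1 := Int.ceil_lt_add_one _
    have h6 : τ ≤ v + (m₀ + i) / L := by
      rw [← sub_le_iff_le_add', le_div_iff₀ hL0]
      nlinarith [(Nat.cast_nonneg i : (0 : ℝ) ≤ i)]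
    have h7 : v + (m₀ + i) / L < 1 - τ := by
      rw [← lt_sub_iff_add_lt', div_lt_iff₀ hL0]
      nlinarith
    have h8 : Int.fract ((2 : ℝ) ^ k * (u + ((f i).val : ℝ) / L)) = v + (m₀ + i) / L := by
      rw [h3, Int.fract_sub_intCast, Int.fract_eq_self]
      constructor <;> linarith
    rw [Finset.mem_filter, h8]
    exact ⟨Finset.mem_univ _, h6, h7⟩
  calc g = (Finset.range g).card := (Finset.card_range g).symm
    _ ≤ _ := Finset.card_le_card_of_injOn f hmaps hinj

lemma pow_le_card_filter_fract {L g : ℕ} [NeZero L] (hL : Nat.Coprime 2 L) {τ : ℝ} (hτ : 0 < τ)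
    (hg : (g : ℝ) ≤ L * (1 - 2 * τ)) (k : ℕ) (u : Fin d → ℝ) :
    g ^ d ≤ (Finset.univ.filter fun a : Fin d → ZMod L => ∀ j,
      τ ≤ Int.fract (2 ^ k * (u j + ((a j).val : ℝ) / L)) ∧
      Int.fract (2 ^ k * (u j + ((a j).val : ℝ) / L)) < 1 - τ).card := by
  have h : (Finset.univ.filter fun a : Fin d → ZMod L => ∀ j,
      τ ≤ Int.fract (2 ^ k * (u j + ((a j).val : ℝ) / L)) ∧
      Int.fract (2 ^ k * (u j + ((a j).val : ℝ) / L)) < 1 - τ) =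
      Fintype.piFinset fun j => Finset.univ.filter fun a : ZMod L =>
        τ ≤ Int.fract (2 ^ k * (u j + (a.val : ℝ) / L)) ∧
        Int.fract (2 ^ k * (u j + (a.val : ℝ) / L)) < 1 - τ := by
    ext a; simp
  rw [h, Fintype.card_piFinset]
  calc g ^ d = ∏ _j : Fin d, g := by simp
    _ ≤ _ := Finset.prod_le_prod' fun j _ => le_card_filter_fract hL hτ hg k (u j)

end Grid

/-- An exponential lower bound for the measure of balls along a geometric sequence of radii bounds
the upper local dimension. -/
lemma upperLocalDim_le {d : ℕ} (μ : Measure (EuclideanSpace ℝ (Fin d))) [IsProbabilityMeasure μ]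
    (x : EuclideanSpace ℝ (Fin d)) {C β γ : ℝ} (hC : 0 < C) (hβ : 0 ≤ β)
    (hβγ : β < γ * Real.log 2)
    (h : ∀ᶠ n : ℕ in atTop, Real.exp (-(β * n)) ≤ (μ (closedBall x (C / 2 ^ n))).toReal) :
    upperLocalDim μ x ≤ (γ : EReal) := by
  have hlog2 := Real.log_pos one_lt_two
  refine Filter.limsup_le_of_le (h := ?_)
  obtain ⟨n₀, hn₀⟩ := eventually_atTop.1 h
  have hlim : Tendsto (fun R : ℝ => -Real.log R) (nhdsWithin 0 (Ioi 0)) atTop :=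
    tendsto_neg_atBot_atTop.comp Real.tendsto_log_nhdsGT_zero
  have hpos : 0 < γ - β / Real.log 2 := by
    rw [sub_pos, div_lt_iff₀ hlog2]; exact hβγ
  filter_upwards [self_mem_nhdsWithin,
    hlim.eventually_ge_atTop (β * (Real.log C / Real.log 2 + 1) / (γ - β / Real.log 2)),
    hlim.eventually_gt_atTop 0, hlim.eventually_ge_atTop (n₀ * Real.log 2 - Real.log C),
    hlim.eventually_ge_atTop (- Real.log C)]
    with R hR0 hR1 hR2 hR3 hR4
  replace hR0 : 0 < R := hR0
  set ℓ := -Real.log R with hℓ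
  set n := ⌈(Real.log C + ℓ) / Real.log 2⌉₊ with hn
  have hn1 : (Real.log C + ℓ) / Real.log 2 ≤ n := Nat.le_ceil _
  have hn2 : (n : ℝ) < (Real.log C + ℓ) / Real.log 2 + 1 :=
    Nat.ceil_lt_add_one (div_nonneg (by linarith) hlog2.le)
  have hnn₀ : n₀ ≤ n := by
    have : (n₀ : ℝ) ≤ n := by
      refine le_trans ?_ hn1
      rw [le_div_iff₀ hlog2]; linarith
    exact_mod_cast this
  have hCR : C / 2 ^ n ≤ R := by
    rw [div_le_iff₀ (by positivity), ← Real.log_le_log_iff hC (by positivity),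
      Real.log_mul hR0.ne' (by positivity), Real.log_pow]
    rw [div_le_iff₀ hlog2] at hn1
    linarith
  have hμ : Real.exp (-(β * n)) ≤ (μ (closedBall x R)).toReal :=
    (hn₀ n hnn₀).trans (ENNReal.toReal_mono (measure_ne_top _ _)
      (measure_mono (closedBall_subset_closedBall hCR)))
  have hlogμ : -(β * n) ≤ Real.log (μ (closedBall x R)).toReal := by
    rw [Real.le_log_iff_exp_le ((Real.exp_pos _).trans_le hμ)]
    exact hμ
  rw [EReal.coe_le_coe_iff, ← neg_div_neg_eq, ← hℓ, div_le_iff₀ hR2]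
  have h1 : β * n ≤ β * ((Real.log C + ℓ) / Real.log 2 + 1) := by gcongr
  have h2 : β * (Real.log C / Real.log 2 + 1) ≤ ℓ * (γ - β / Real.log 2) :=
    (div_le_iff₀ hpos).1 hR1
  have h3 : β * ((Real.log C + ℓ) / Real.log 2 + 1) =
      β * (Real.log C / Real.log 2 + 1) + ℓ * (β / Real.log 2) := by ring
  nlinarith

lemma exists_mul_card_le_card_mul {A κ : Type*} [Fintype A] [Nonempty A] (I : Finset κ)
    (P : A → κ → Prop) [∀ a, DecidablePred (P a)] {m : ℕ}
    (h : ∀ k ∈ I, m ≤ (Finset.univ.filter fun a => P a k).card) :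
    ∃ a, m * I.card ≤ Fintype.card A * (I.filter (P a)).card := by
  by_contra! hlt
  have h1 : ∑ a, (I.filter (P a)).card = ∑ k ∈ I, (Finset.univ.filter fun a => P a k).card :=
    Finset.sum_card_bipartiteAbove_eq_sum_card_bipartiteBelow P
  have h2 : m * I.card ≤ ∑ a, (I.filter (P a)).card := by
    rw [h1, mul_comm, ← smul_eq_mul]
    exact Finset.card_nsmul_le_sum _ _ _ h
  have h3 : ∑ a, Fintype.card A * (I.filter (P a)).card < ∑ _a : A, m * I.card :=
    Finset.sum_lt_sum_of_nonempty Finset.univ_nonempty fun a _ => hlt a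
  rw [← Finset.mul_sum, Finset.sum_const, smul_eq_mul, Finset.card_univ] at h3
  exact absurd h2 (Nat.not_le.2 (Nat.lt_of_mul_lt_mul_left h3))

lemma exists_two_pow_mul_mem_Icc {θ : ℝ} (hθ : 0 < θ) (hθ3 : θ ≤ 3) :
    ∃ p : ℕ, 1 ≤ p ∧ 3 ≤ 2 ^ p * θ ∧ 2 ^ p * θ ≤ 6 := by
  obtain ⟨n, hn1, hn2⟩ := exists_nat_pow_near ((one_le_div hθ).2 hθ3) one_lt_two
  refine ⟨n + 1, by omega, ((div_lt_iff₀ hθ).1 hn2).le, ?_⟩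
  rw [le_div_iff₀ hθ] at hn1
  rw [pow_succ]
  linarith

lemma pow_le_floor_div_pow_mul {d p : ℕ} {θ : ℝ} (hθ : 0 < θ) (h3 : 3 ≤ 2 ^ p * θ)
    (h6 : 2 ^ p * θ ≤ 6) :
    (θ / 12) ^ d ≤
      ((⌊(13 : ℝ) * (1 - 2 * (2 ^ p * θ)⁻¹)⌋₊ : ℝ) / 13) ^ d * (((2 ^ d : ℕ) : ℝ)⁻¹ ^ p) := by
  have h1 : (((2 ^ d : ℕ) : ℝ)⁻¹ ^ p) = (θ / (2 ^ p * θ)) ^ d := by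
    have : θ / (2 ^ p * θ) = (2 ^ p)⁻¹ := by field_simp
    rw [this]
    push_cast
    rw [inv_pow, inv_pow, ← pow_mul, ← pow_mul, mul_comm]
  set σ := 2 ^ p * θ
  rw [h1, ← mul_pow]
  have hσ : 0 < σ := by linarith
  refine pow_le_pow_left₀ (by positivity) ?_ d
  have h2 := Nat.lt_floor_add_one ((13 : ℝ) * (1 - 2 * σ⁻¹))
  set g := (⌊(13 : ℝ) * (1 - 2 * σ⁻¹)⌋₊ : ℝ)
  have h4 : σ ≤ 12 * (g / 13) := by
    have h5 : 12 * (12 / 13 - 2 * σ⁻¹) ≤ 12 * (g / 13) := by linarith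
    refine le_trans ?_ h5
    rw [← sub_nonneg]
    have : 12 * (12 / 13 - 2 * σ⁻¹) - σ = (144 / 13 * σ - 24 - σ ^ 2) / σ := by
      field_simp
      ring
    rw [this]
    apply div_nonneg _ hσ.le
    nlinarith [mul_nonneg (sub_nonneg.2 h3) (sub_nonneg.2 h6)]
  calc θ / 12 = σ * (θ / σ) / 12 := by field_simp
    _ ≤ 12 * (g / 13) * (θ / σ) / 12 := by gcongr
    _ = _ := by ring

lemma exists_pos_ae_eventually_forall_gridIdx {d : ℕ} (hd : 1 ≤ d)
    (μ : Measure (EuclideanSpace ℝ (Fin d))) [IsProbabilityMeasure μ] {A : Type*} [Fintype A]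
    [Nonempty A] (t : A → Fin d → ℝ) (S : ℝ) {p : ℕ} (hp : 1 ≤ p) {δ : ℝ} (hδ : 0 < δ) :
    ∃ ε > 0, ∀ᵐ x ∂μ, ∀ᶠ n : ℕ in atTop, ∀ a,
      Real.exp (-δ * n) * (((2 ^ d : ℕ) : ℝ)⁻¹ ^ n * Real.exp (((2 ^ d : ℕ) : ℝ)⁻¹ ^ p / 2 *
        Set.ncard {k : ℕ | k < n ∧ ∃ w, gridParent^[p] w = gridIdx S (t a) k x ∧
          μ {y | gridIdx S (t a) (k + p) y = w} ≤
            ENNReal.ofReal ε * μ {y | gridIdx S (t a) k y = gridIdx S (t a) k x}})) ≤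
        (μ {y | gridIdx S (t a) n y = gridIdx S (t a) n x}).toReal := by
  have hb : 2 ≤ 2 ^ d := by
    calc 2 = 2 ^ 1 := rfl
      _ ≤ _ := Nat.pow_le_pow_right (by norm_num) hd
  choose ε hε h using fun a => exists_pos_ae_eventually_le_measure μ
    (fun z z' => mem_gridChildren (d := d) z z') card_gridChildren hb
    (measurable_gridIdx S (t a)) (gridParent_gridIdx S (t a)) hp hδ
  refine ⟨Finset.univ.inf' Finset.univ_nonempty ε, (Finset.lt_inf'_iff _).2 fun a _ => hε a, ?_⟩
  filter_upwards [ae_all_iff.2 h] with x hx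
  filter_upwards [eventually_all.2 hx] with n hn a
  refine le_trans ?_ (hn a)
  gcongr
  · exact (Set.finite_lt_nat n).subset fun k hk => hk.1
  · exact Finset.inf'_le _ (Finset.mem_univ a)

set_option maxHeartbeats 400000 in
lemma ae_upperLocalDim_le_of_scale {d : ℕ} (hd : 1 ≤ d) {α η : ℝ} (hα : 0 < α) (hα' : α ≤ 1 / 2)
    (hη : 0 < η) (hη' : η ≤ 1) (μ : Measure (EuclideanSpace ℝ (Fin d))) [IsProbabilityMeasure μ]
    {ρ : ℝ} (hρ : 0 < ρ) :
    ∀ᵐ x ∂μ, ∀ r : ℝ, 7 / 8 * ρ ≤ r → r ≤ ρ → (∀ ε > (0 : ℝ), η ≤ Filter.liminf (fun n : ℕ =>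
      (Set.ncard {i : ℕ | i < n ∧ α ≤ por μ x (r * (2 : ℝ) ^ (-(i : ℝ))) ε} : ℝ) / n) atTop) →
      upperLocalDim μ x ≤
        ((d - 2 / 5 * (α / (16 * √d)) ^ d * η / Real.log 2 : ℝ) : EReal) := by
  classical
  have hd1 : (1 : ℝ) ≤ d := by exact_mod_cast hd
  have hsd : 1 ≤ √(d : ℝ) := Real.one_le_sqrt.2 hd1
  have hsd0 : 0 < √(d : ℝ) := by linarith
  set θ : ℝ := 3 / 4 * α / √d with hθ
  have hθ0 : 0 < θ := by positivity
  have hθ3 : θ ≤ 3 := by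
    rw [hθ, div_le_iff₀ hsd0]; nlinarith
  obtain ⟨p, hp, h3, h6⟩ := exists_two_pow_mul_mem_Icc hθ0 hθ3
  have hnum := pow_le_floor_div_pow_mul (d := d) hθ0 h3 h6
  have hθ12 : θ / 12 = α / (16 * √d) := by rw [hθ]; field_simp; norm_num
  rw [hθ12] at hnum
  set σ : ℝ := 2 ^ p * θ with hσ
  have hσ0 : 0 < σ := by linarith
  set g : ℕ := ⌊(13 : ℝ) * (1 - 2 * σ⁻¹)⌋₊ with hg
  have hσ3 : σ⁻¹ ≤ 1 / 3 := by rw [inv_le_comm₀ hσ0 (by norm_num)]; linarith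
  have hg' : (g : ℝ) ≤ (13 : ℕ) * (1 - 2 * σ⁻¹) := by
    push_cast
    exact Nat.floor_le (by linarith)
  set v : ℝ := ((2 ^ d : ℕ) : ℝ)⁻¹ ^ p with hv
  set B : ℝ := 2 / 5 * (α / (16 * √d)) ^ d with hB
  have hB0 : 0 < B := by positivity
  have hB1 : B ≤ 2 / 5 := by
    have : (α / (16 * √d)) ^ d ≤ 1 := pow_le_one₀ (by positivity) (by
      rw [div_le_one (by positivity)]; linarith)
    linarith
  have hS : 0 < σ * ρ := by positivity
  set S : ℝ := σ * ρ with hSdef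
  obtain ⟨ε, hε, h⟩ := exists_pos_ae_eventually_forall_gridIdx hd μ
    (fun (a : Fin d → ZMod 13) j => ((a j).val : ℝ) / (13 : ℕ)) S hp
    (show 0 < B * η / 16 by positivity)
  filter_upwards [h] with x hx r hr1 hr2 hr
  have hr0 : 0 < r := by linarith [mul_pos (show (0 : ℝ) < 7 / 8 by norm_num) hρ]
  have hlog2 := Real.log_two_gt_d9
  have hbη : B * η ≤ 2 / 5 := by nlinarith
  refine upperLocalDim_le μ x (C := √d * S) (β := d * Real.log 2 - 17 / 16 * (B * η))
    (by positivity) (by nlinarith) ?_ ?_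
  · rw [sub_mul, div_mul_cancel₀ _ (by positivity)]
    nlinarith [mul_pos hB0 hη]
  have hlim := eventually_lt_of_lt_liminf
    (lt_of_lt_of_le (show 9 / 10 * η < η by linarith) (hr ε hε))
    (isBoundedUnder_of ⟨0, fun n => by positivity⟩)
  filter_upwards [hx, hlim, eventually_gt_atTop 0] with n hn hporn hn0
  have hn0' : (0 : ℝ) < n := by exact_mod_cast hn0
  set I := (Finset.range n).filter fun i : ℕ => α ≤ por μ x (r * (2 : ℝ) ^ (-(i : ℝ))) ε with hI
  have hIset : {i : ℕ | i < n ∧ α ≤ por μ x (r * (2 : ℝ) ^ (-(i : ℝ))) ε} = I := by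
    ext i; simp [hI]
  rw [hIset, Set.ncard_coe_finset, lt_div_iff₀ hn0'] at hporn
  obtain ⟨a, ha⟩ := exists_mul_card_le_card_mul I (fun (a : Fin d → ZMod 13) k => ∀ j,
    σ⁻¹ ≤ Int.fract (2 ^ k * (x j / S + ((a j).val : ℝ) / (13 : ℕ))) ∧
      Int.fract (2 ^ k * (x j / S + ((a j).val : ℝ) / (13 : ℕ))) < 1 - σ⁻¹)
    (fun k _ => pow_le_card_filter_fract (by norm_num) (inv_pos.2 hσ0) hg' k fun j => x j / S)
  specialize hn a
  set N := Set.ncard {k : ℕ | k < n ∧ ∃ w,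
    gridParent^[p] w = gridIdx S (fun j => ((a j).val : ℝ) / (13 : ℕ)) k x ∧
      μ {y | gridIdx S (fun j => ((a j).val : ℝ) / (13 : ℕ)) (k + p) y = w} ≤
        ENNReal.ofReal ε * μ {y | gridIdx S (fun j => ((a j).val : ℝ) / (13 : ℕ)) k y =
          gridIdx S (fun j => ((a j).val : ℝ) / (13 : ℕ)) k x}} with hN
  have haN : g ^ d * I.card ≤ 13 ^ d * N := by
    refine ha.trans ?_
    rw [Fintype.card_fun, ZMod.card, Fintype.card_fin]
    refine Nat.mul_le_mul_left _ ?_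
    rw [← Set.ncard_coe_finset]
    refine Set.ncard_le_ncard (fun k hk => ?_) ((Set.finite_lt_nat n).subset fun k hk => hk.1)
    rw [Finset.mem_coe, Finset.mem_filter, hI, Finset.mem_filter, Finset.mem_range] at hk
    obtain ⟨⟨hkn, hkpor⟩, hkx⟩ := hk
    have h2k : (2 : ℝ) ^ (-(k : ℝ)) = (2 ^ k)⁻¹ := by
      rw [Real.rpow_neg (by norm_num), Real.rpow_natCast]
    rw [h2k] at hkpor
    refine ⟨hkn, exists_gridIdx_measure_le μ (α' := 7 / 8 * α) hS hkx (by positivity) ?_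
      (by positivity) (by linarith) hkpor ?_⟩
    · calc (2 : ℝ) ^ k * (r * (2 ^ k)⁻¹) = r := by field_simp
        _ ≤ ρ := hr2
        _ = σ⁻¹ * S := by rw [hSdef]; field_simp
    · calc √d * (S / 2 ^ (k + p)) = 3 / 4 * α * ρ * (2 ^ k)⁻¹ := by
            rw [hSdef, hσ, hθ, pow_add]; field_simp
        _ ≤ 7 / 8 * α * r * (2 ^ k)⁻¹ := by
            gcongr ?_ * _
            nlinarith
        _ = _ := by ring
  have hNI : 9 / 8 * (B * η) * n ≤ v / 2 * N := by
    have h1 : (g / 13 : ℝ) ^ d * I.card ≤ N := by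
      rw [div_pow, div_mul_eq_mul_div, div_le_iff₀ (by positivity), mul_comm (N : ℝ)]
      exact_mod_cast haN
    calc 9 / 8 * (B * η) * n = 5 / 4 * B * (9 / 10 * η * n) := by ring
      _ ≤ 5 / 4 * B * I.card := by gcongr
      _ = 1 / 2 * (α / (16 * √d)) ^ d * I.card := by rw [hB]; ring
      _ ≤ 1 / 2 * ((g / 13 : ℝ) ^ d * v) * I.card := by gcongr
      _ = v / 2 * ((g / 13 : ℝ) ^ d * I.card) := by ring
      _ ≤ _ := by gcongr
  have hpow : ((2 ^ d : ℕ) : ℝ)⁻¹ ^ n = Real.exp (-(d * Real.log 2 * n)) := by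
    push_cast
    rw [Real.exp_neg, mul_comm, Real.exp_nat_mul, Real.exp_nat_mul, Real.exp_log two_pos, inv_pow]
  calc Real.exp (-((d * Real.log 2 - 17 / 16 * (B * η)) * n))
      ≤ Real.exp (-(B * η / 16) * n) * (((2 ^ d : ℕ) : ℝ)⁻¹ ^ n * Real.exp (v / 2 * N)) := by
        rw [hpow, ← Real.exp_add, ← Real.exp_add, Real.exp_le_exp]
        nlinarith
    _ ≤ _ := hn
    _ ≤ _ := by
        refine ENNReal.toReal_mono (measure_ne_top _ _) (measure_mono fun y hy => ?_)
        rw [mem_closedBall, mul_div_assoc]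
        exact dist_le_of_gridIdx_eq hS hy

/-- If for `μ`-a.e. `x` there is `r(x) ∈ (0,1]` such that for every `ε > 0`,
`liminf_n (1/n)·#{i < n : por(μ,x,r(x)·2^{-i},ε) ≥ α} ≥ η`, then
`dim_P(μ) ≤ d − c_d·η·α^d` with `c_d = 2/(5·log 2·2^{4d}·d^{d/2})`. -/
theorem packingDim_le_of_meanPorous_beliaevSmirnov (d : ℕ) (hd : 1 ≤ d) (α η : ℝ)
    (hα : 0 < α) (hα' : α ≤ 1 / 2) (hη : 0 < η) (hη' : η ≤ 1)
    (μ : Measure (EuclideanSpace ℝ (Fin d))) [IsProbabilityMeasure μ]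
    (hpor : ∀ᵐ x ∂μ, ∃ r ∈ Set.Ioc (0 : ℝ) 1, ∀ ε > (0 : ℝ),
      η ≤ Filter.liminf
        (fun n : ℕ =>
          (Set.ncard {i : ℕ | i < n ∧ α ≤ por μ x (r * (2 : ℝ) ^ (-(i : ℝ))) ε} : ℝ) / n)
        Filter.atTop) :
    packingDim μ ≤
      (((d : ℝ) - 2 / (5 * Real.log 2 * 2 ^ (4 * d) * (d : ℝ) ^ ((d : ℝ) / 2)) * η * α ^ d
        : ℝ) : EReal) := by
  have hlog2 := Real.log_pos one_lt_two
  have hconst : 2 / (5 * Real.log 2 * 2 ^ (4 * d) * (d : ℝ) ^ ((d : ℝ) / 2)) * η * α ^ d =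
      2 / 5 * (α / (16 * √d)) ^ d * η / Real.log 2 := by
    have hd0 : (0 : ℝ) < d := by exact_mod_cast hd
    have h1 : (d : ℝ) ^ ((d : ℝ) / 2) = √d ^ d := by
      rw [Real.sqrt_eq_rpow, ← Real.rpow_natCast, ← Real.rpow_mul hd0.le]
      congr 1; ring
    have h2 : (2 : ℝ) ^ (4 * d) = 16 ^ d := by rw [pow_mul]; norm_num
    have h3 : 0 < √(d : ℝ) := Real.sqrt_pos.2 hd0
    rw [h1, h2, div_pow, mul_pow]
    field_simp
  rw [hconst]
  have hscale : ∀ᵐ x ∂μ, ∀ q : ℚ, 0 < q → ∀ r : ℝ, 7 / 8 * (q : ℝ) ≤ r → r ≤ q →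
      (∀ ε > (0 : ℝ), η ≤ Filter.liminf (fun n : ℕ =>
        (Set.ncard {i : ℕ | i < n ∧ α ≤ por μ x (r * (2 : ℝ) ^ (-(i : ℝ))) ε} : ℝ) / n) atTop) →
      upperLocalDim μ x ≤
        ((d - 2 / 5 * (α / (16 * √d)) ^ d * η / Real.log 2 : ℝ) : EReal) := by
    refine ae_all_iff.2 fun q => ?_
    by_cases hq : 0 < q
    · filter_upwards [ae_upperLocalDim_le_of_scale hd hα hα' hη hη' μ (Rat.cast_pos.2 hq)]
        with x hx _ using hx
    · exact Eventually.of_forall fun x h => absurd h hq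
  refine essSup_le_of_ae_le _ ?_
  filter_upwards [hpor, hscale] with x ⟨r, hr, hx⟩ h
  obtain ⟨q, hq1, hq2⟩ := exists_rat_btwn (show r < 8 / 7 * r by linarith [hr.1])
  exact h q (by exact_mod_cast hr.1.trans hq1) r (by linarith) hq1.le hx
end
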